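/- arXiv:1802.07112 — 5 statements merged into one kernel-verified Lean document; each statement's English description precedes it below -/
import Mathlib

section
/- For every fixed real v > 0, lim_{n→∞} n^{1−v} · x_n(v)/x_n(1) = 2^{v−1}/Γ(v); that is, the probability generating function of the number of vertices X_n of a uniform random rooted map with n edges satisfies E(v^{X_n}) = (2^{v−1}/Γ(v))·n^{v−1}·(1 + o(1)). -/
open Polynomial Filter

/-- The coefficients of the power series `G` with `G₀ = 1` whose logarithmic derivative
linearises the Riccati recurrence started at `v`. -/
noncomputable def riccatiCoeff (v : ℝ) (n : ℕ) : ℝ :=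
  (∏ j ∈ Finset.range (2 * n), (v + j)) / (2 ^ n * n.factorial)

@[simp] lemma riccatiCoeff_zero (v : ℝ) : riccatiCoeff v 0 = 1 := by
  simp [riccatiCoeff]

lemma riccatiCoeff_succ (v : ℝ) (n : ℕ) :
    2 * ((n : ℝ) + 1) * riccatiCoeff v (n + 1) =
      (2 * n + v) * (2 * n + v + 1) * riccatiCoeff v n := by
  have h : (n.factorial : ℝ) ≠ 0 := by exact_mod_cast n.factorial_ne_zero
  have h' : (n : ℝ) + 1 ≠ 0 := by positivity
  simp only [riccatiCoeff, show 2 * (n + 1) = 2 * n + 1 + 1 by ring, Finset.prod_range_succ,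
    Nat.factorial_succ, pow_succ]
  push_cast
  field_simp
  ring

lemma riccatiCoeff_pos {v : ℝ} (hv : 0 < v) (n : ℕ) : 0 < riccatiCoeff v n := by
  unfold riccatiCoeff
  have : 0 < ∏ j ∈ Finset.range (2 * n), (v + j) := Finset.prod_pos fun j _ => by positivity
  positivity

/-- A convolution square is controlled by its summands when the ratios `h (n + 1) / h n` grow
like `2 n`. -/
lemma exists_sum_mul_le {h : ℕ → ℝ} (hpos : ∀ n, 0 < h n) {B : ℝ} (hB : 0 ≤ B)
    (hle : ∀ n : ℕ, h (n + 1) ≤ (2 * n + B) * h n) (hge : ∀ n : ℕ, 2 * n * h n ≤ h (n + 1)) :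
    ∃ K : ℝ, ∀ n, ∑ i ∈ Finset.range (n + 1), h i * h (n - i) ≤ K * h n := by
  set S : ℕ → ℝ := fun n => ∑ i ∈ Finset.range (n + 1), h i * h (n - i) with hS
  have Spos (n) : 0 ≤ S n := Finset.sum_nonneg fun i _ => by
    have := hpos i; have := hpos (n - i); positivity
  have weighted (n : ℕ) :
      (n : ℝ) * S n = 2 * ∑ i ∈ Finset.range (n + 1), ((n : ℝ) - i) * (h i * h (n - i)) := by
    have key : ∑ i ∈ Finset.range (n + 1), ((n : ℝ) - i) * (h i * h (n - i)) =
        ∑ i ∈ Finset.range (n + 1), (i : ℝ) * (h i * h (n - i)) := by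
      rw [← Finset.sum_range_reflect]
      refine Finset.sum_congr rfl fun i hi => ?_
      have hi' : i ≤ n := by simpa [Nat.lt_succ_iff] using hi
      rw [show n + 1 - 1 - i = n - i by omega, show n - (n - i) = i by omega, Nat.cast_sub hi']
      ring
    rw [two_mul]
    nth_rewrite 2 [key]
    rw [← Finset.sum_add_distrib, hS, Finset.mul_sum]
    refine Finset.sum_congr rfl fun i _ => by ring
  have step (n : ℕ) : S (n + 1) ≤ 2 * h 0 * h (n + 1) + (n + 2 * B) * S n := by
    have hw := weighted (n + 1)
    rw [Finset.sum_range_succ'] at hw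
    have hsum : ∑ i ∈ Finset.range (n + 1),
        (((n + 1 : ℕ) : ℝ) - (i + 1 : ℕ)) * (h (i + 1) * h (n + 1 - (i + 1))) ≤
        ((n : ℝ) ^ 2 / 2 + B * n) * S n := by
      rw [hS, Finset.mul_sum]
      refine Finset.sum_le_sum fun i hi => ?_
      have hi' : (i : ℝ) ≤ n := by
        have : i ≤ n := by simpa [Nat.lt_succ_iff] using hi
        exact_mod_cast this
      rw [show n + 1 - (i + 1) = n - i by omega]
      have hp : 0 < h i * h (n - i) := mul_pos (hpos _) (hpos _)
      have h1 : h (i + 1) * h (n - i) ≤ (2 * i + B) * (h i * h (n - i)) := by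
        rw [← mul_assoc]
        exact mul_le_mul_of_nonneg_right (hle i) (hpos _).le
      have h2 : ((n : ℝ) - i) * (2 * i + B) ≤ (n : ℝ) ^ 2 / 2 + B * n := by
        nlinarith [sq_nonneg ((n : ℝ) - 2 * i), mul_nonneg hB (Nat.cast_nonneg (α := ℝ) i)]
      push_cast
      calc ((n : ℝ) + 1 - (i + 1)) * (h (i + 1) * h (n - i))
          ≤ ((n : ℝ) - i) * ((2 * i + B) * (h i * h (n - i))) := by
            rw [show (n : ℝ) + 1 - (i + 1) = n - i by ring]
            exact mul_le_mul_of_nonneg_left h1 (by linarith)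
        _ = (((n : ℝ) - i) * (2 * i + B)) * (h i * h (n - i)) := by ring
        _ ≤ _ := mul_le_mul_of_nonneg_right h2 hp.le
    push_cast at hw hsum
    simp only [sub_zero] at hw
    have hn : (0 : ℝ) ≤ n := Nat.cast_nonneg n
    have hfin : ((n : ℝ) + 1) * S (n + 1) ≤
        ((n : ℝ) + 1) * (2 * h 0 * h (n + 1) + (n + 2 * B) * S n) := by
      have := Spos n
      nlinarith [mul_nonneg hn this, mul_nonneg hB this]
    exact le_of_mul_le_mul_left hfin (by positivity)
  obtain ⟨N, hN⟩ := exists_nat_ge (4 * B + 1)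
  have hge' (n : ℕ) : N ≤ n → S n ≤ (S N / h N + 8 * h 0) * h n := by
    intro hn
    induction n, hn using Nat.le_induction with
    | base =>
      have := hpos N
      have := mul_pos (hpos 0) this
      rw [add_mul, div_mul_cancel₀ _ (hpos N).ne']
      linarith
    | succ n hn ih =>
      have hn' : 4 * B + 1 ≤ n := hN.trans (by exact_mod_cast hn)
      set K := S N / h N + 8 * h 0 with hK
      have hK8 : 8 * h 0 ≤ K := by
        have := div_nonneg (Spos N) (hpos N).le
        linarith
      have h0 := hpos 0
      have h1 := hge n
      have h2 := hpos n
      have h3 : (n + 2 * B) * S n ≤ 3 / 4 * K * h (n + 1) := by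
        calc (n + 2 * B) * S n ≤ (n + 2 * B) * (K * h n) :=
              mul_le_mul_of_nonneg_left ih (by positivity)
          _ ≤ (3 / 2 * n) * (K * h n) :=
              mul_le_mul_of_nonneg_right (by linarith) (mul_nonneg (by linarith) h2.le)
          _ = 3 / 4 * K * (2 * n * h n) := by ring
          _ ≤ _ := mul_le_mul_of_nonneg_left h1 (by linarith)
      have h4 := step n
      nlinarith [hpos (n + 1)]
  refine ⟨S N / h N + 8 * h 0 + ∑ m ∈ Finset.range N, S m / h m, fun n => ?_⟩
  have hrest : 0 ≤ ∑ m ∈ Finset.range N, S m / h m :=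
    Finset.sum_nonneg fun m _ => div_nonneg (Spos m) (hpos m).le
  rcases le_or_gt N n with hn | hn
  · refine (hge' n hn).trans (mul_le_mul_of_nonneg_right (by linarith) (hpos n).le)
  · have h1 : S n / h n ≤ ∑ m ∈ Finset.range N, S m / h m :=
      Finset.single_le_sum (f := fun m => S m / h m)
        (fun m _ => div_nonneg (Spos m) (hpos m).le) (Finset.mem_range.2 hn)
    have h2 := div_nonneg (Spos N) (hpos N).le
    rw [← div_le_iff₀ (hpos n)]
    linarith [hpos 0]

/-- The solution of the Riccati recurrence, multiplied by the series `G` of `riccatiCoeff`, is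
`v G + 2 z G'`. -/
lemma sum_mul_riccatiCoeff {v : ℝ} {y : ℕ → ℝ} (hy0 : y 0 = v)
    (hy : ∀ n : ℕ, y (n + 1) =
      (2 * ((n : ℝ) + 1) - 1) * y n + ∑ i ∈ Finset.range (n + 1), y i * y (n - i)) (n : ℕ) :
    ∑ i ∈ Finset.range (n + 1), y i * riccatiCoeff v (n - i) =
      (v + 2 * n) * riccatiCoeff v n := by
  let D := PowerSeries.derivative ℝ
  let Z : PowerSeries ℝ := PowerSeries.X
  let c : PowerSeries ℝ := PowerSeries.C v
  let Y : PowerSeries ℝ := PowerSeries.mk y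
  let G : PowerSeries ℝ := PowerSeries.mk (riccatiCoeff v)
  obtain ⟨W, hW⟩ : ∃ W : PowerSeries ℝ, W = 2 * (Z * D G) + c * G := ⟨_, rfl⟩
  have two : (2 : PowerSeries ℝ) = PowerSeries.C 2 := (map_ofNat _ 2).symm
  have coeff_zD (F : PowerSeries ℝ) (n : ℕ) :
      PowerSeries.coeff n (Z * D F) = n * PowerSeries.coeff n F := by
    cases n with
    | zero => simp [Z]
    | succ n => simp [Z, D, PowerSeries.coeff_succ_X_mul, PowerSeries.coeff_derivative, mul_comm]
  have hY : Y = c + Z * (Y + 2 * (Z * D Y) + Y * Y) := by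
    ext n
    cases n with
    | zero => simp [Y, c, Z, hy0]
    | succ n =>
      rw [map_add, PowerSeries.coeff_succ_X_mul, map_add, map_add, two,
        PowerSeries.coeff_C_mul, coeff_zD, PowerSeries.coeff_mul,
        Finset.Nat.sum_antidiagonal_eq_sum_range_succ_mk]
      simp [Y, c, hy]
      ring
  have hG : 2 * (Z * D G) = Z * (2 * (Z * D W) + (c + 1) * W) := by
    ext n
    cases n with
    | zero => simp [Z]
    | succ n =>
      rw [PowerSeries.coeff_succ_X_mul, add_mul, one_mul, map_add, map_add, two,
        PowerSeries.coeff_C_mul, coeff_zD, PowerSeries.coeff_C_mul, coeff_zD,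
        PowerSeries.coeff_C_mul]
      rw [hW, two, map_add, PowerSeries.coeff_C_mul, coeff_zD, PowerSeries.coeff_C_mul]
      simp only [G, PowerSeries.coeff_mk]
      have := riccatiCoeff_succ v n
      push_cast
      linear_combination this
  have hE : Y * G - W = Z * (2 * (Z * D (Y * G - W)) + (1 + c) * (Y * G - W)
      + Y * (Y * G - W)) := by
    have hD : D (Y * G - W) = Y * D G + G * D Y - D W := by
      simp [D, Derivation.leibniz]
    rw [hD]
    linear_combination G * hY - hG + (1 - Z * Y) * (-hW)
  have hzero (n : ℕ) : PowerSeries.coeff n (Y * G - W) = 0 := by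
    induction n using Nat.strong_induction_on with
    | _ n ih =>
      rw [hE]
      cases n with
      | zero => simp [Z]
      | succ n =>
        rw [PowerSeries.coeff_succ_X_mul, add_mul, one_mul, map_add, map_add, map_add, two,
          PowerSeries.coeff_C_mul, coeff_zD, PowerSeries.coeff_C_mul, ih n (by omega),
          PowerSeries.coeff_mul, Finset.sum_eq_zero]
        · simp
        · intro p hp
          rw [ih p.2 (by have := Finset.HasAntidiagonal.mem_antidiagonal.1 hp; omega), mul_zero]
  have h := hzero n
  rw [hW, map_sub, sub_eq_zero, PowerSeries.coeff_mul,
    Finset.Nat.sum_antidiagonal_eq_sum_range_succ_mk, map_add, two, PowerSeries.coeff_C_mul,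
    coeff_zD, PowerSeries.coeff_C_mul] at h
  simp only [Y, G, PowerSeries.coeff_mk] at h
  rw [h]
  ring

/-- The inner part of the convolution square of `riccatiCoeff` is negligible. -/
lemma exists_sum_riccatiCoeff_le {v : ℝ} (hv : 0 < v) :
    ∃ K : ℝ, ∀ n : ℕ, ∑ i ∈ Finset.range (n + 1),
      riccatiCoeff v (i + 1) * riccatiCoeff v (n - i + 1) ≤ K * riccatiCoeff v (n + 1) := by
  have hrec (n : ℕ) := riccatiCoeff_succ v (n + 1)
  push_cast at hrec
  refine exists_sum_mul_le (h := fun n => riccatiCoeff v (n + 1)) (B := (v + 2) * (v + 3))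
    (fun n => riccatiCoeff_pos hv _) (by positivity) (fun n => ?_) (fun n => ?_)
  · have h := riccatiCoeff_pos hv (n + 1)
    refine le_of_mul_le_mul_left ?_ (show (0 : ℝ) < 2 * (n + 1 + 1) by positivity)
    rw [hrec, ← mul_assoc]
    refine mul_le_mul_of_nonneg_right ?_ h.le
    have hn : (0 : ℝ) ≤ n := Nat.cast_nonneg n
    nlinarith [mul_nonneg hn hv.le, mul_nonneg hn (sq_nonneg v), sq_nonneg v]
  · have h := riccatiCoeff_pos hv (n + 1)
    refine le_of_mul_le_mul_left ?_ (show (0 : ℝ) < 2 * (n + 1 + 1) by positivity)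
    rw [hrec, ← mul_assoc]
    refine mul_le_mul_of_nonneg_right ?_ h.le
    have hn : (0 : ℝ) ≤ n := Nat.cast_nonneg n
    nlinarith [mul_nonneg hn hv.le]

/-- The solution of the Riccati recurrence is asymptotic to `(v + 2 n) * riccatiCoeff v n`. -/
lemma tendsto_div_riccatiCoeff {v : ℝ} (hv : 0 < v) {y : ℕ → ℝ} (hy0 : y 0 = v)
    (hy : ∀ n : ℕ, y (n + 1) =
      (2 * ((n : ℝ) + 1) - 1) * y n + ∑ i ∈ Finset.range (n + 1), y i * y (n - i)) :
    Tendsto (fun n : ℕ => y n / ((v + 2 * n) * riccatiCoeff v n)) atTop (nhds 1) := by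
  have ypos (n : ℕ) : 0 < y n := by
    induction n using Nat.strong_induction_on with
    | _ n ih =>
      cases n with
      | zero => rwa [hy0]
      | succ n =>
        rw [hy]
        have h1 := ih n (by omega)
        have h2 : 0 ≤ ∑ i ∈ Finset.range (n + 1), y i * y (n - i) :=
          Finset.sum_nonneg fun i hi => (mul_pos (ih i (by simpa using hi))
            (ih (n - i) (by omega))).le
        have h3 : (0 : ℝ) < 2 * ((n : ℝ) + 1) - 1 := by
          have : (0 : ℝ) ≤ n := Nat.cast_nonneg n
          linarith
        have := mul_pos h3 h1
        linarith
  have gpos := riccatiCoeff_pos hv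
  have hsum (n : ℕ) : ∑ i ∈ Finset.range n, y i * riccatiCoeff v (n - i) + y n =
      (v + 2 * n) * riccatiCoeff v n := by
    rw [← sum_mul_riccatiCoeff hy0 hy n, Finset.sum_range_succ]
    simp
  have yle (n : ℕ) : y n ≤ (v + 2 * n) * riccatiCoeff v n := by
    rw [← hsum n]
    have := Finset.sum_nonneg fun i (_ : i ∈ Finset.range n) =>
      (mul_pos (ypos i) (gpos (n - i))).le
    linarith
  obtain ⟨K, hK⟩ := exists_sum_riccatiCoeff_le hv
  have low (n : ℕ) : (v + 2 * (n + 2 : ℕ)) * riccatiCoeff v (n + 2) - v * riccatiCoeff v (n + 2)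
      - (v + 2 * (n + 2 : ℕ)) * (K * riccatiCoeff v (n + 1)) ≤ y (n + 2) := by
    have h1 := hsum (n + 2)
    rw [Finset.sum_range_succ', hy0] at h1
    have h2 : ∑ i ∈ Finset.range (n + 1), y (i + 1) * riccatiCoeff v (n + 2 - (i + 1)) ≤
        (v + 2 * (n + 2 : ℕ)) * (K * riccatiCoeff v (n + 1)) := by
      refine le_trans ?_ (mul_le_mul_of_nonneg_left (hK n) (by positivity))
      rw [Finset.mul_sum]
      refine Finset.sum_le_sum fun i hi => ?_
      have hi' : i ≤ n := by simpa [Nat.lt_succ_iff] using hi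
      rw [show n + 2 - (i + 1) = n - i + 1 by omega, ← mul_assoc]
      refine mul_le_mul_of_nonneg_right ((yle _).trans ?_) (gpos _).le
      refine mul_le_mul_of_nonneg_right ?_ (gpos _).le
      have : ((i + 1 : ℕ) : ℝ) ≤ (n + 2 : ℕ) := by exact_mod_cast (by omega)
      linarith
    simp only [Nat.sub_zero] at h1
    linarith
  have inv_lim (a b : ℝ) : Tendsto (fun n : ℕ => a / (b + 2 * ((n : ℕ) : ℝ))) atTop (nhds 0) :=
    Tendsto.const_div_atTop (tendsto_atTop_add_const_left _ _
      (tendsto_natCast_atTop_atTop.const_mul_atTop two_pos)) _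
  have Knn : 0 ≤ K := by
    have h1 := hK 0
    have h2 := gpos 1
    simp only [zero_add, Finset.range_one, Finset.sum_singleton, Nat.sub_zero] at h1
    exact le_of_mul_le_mul_right (by nlinarith) h2
  rw [← tendsto_add_atTop_iff_nat 2]
  refine tendsto_of_tendsto_of_tendsto_of_le_of_le
    (g := fun n : ℕ => 1 - v / (v + 4 + 2 * n) - K / (1 + 2 * n)) ?_ tendsto_const_nhds ?_ ?_
  · simpa using (tendsto_const_nhds (x := (1 : ℝ))).sub (inv_lim v (v + 4)) |>.sub (inv_lim K 1)
  · intro n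
    have g2 := gpos (n + 2)
    have g1 := gpos (n + 1)
    have hp : 0 < (v + 2 * (n + 2 : ℕ)) * riccatiCoeff v (n + 2) := by positivity
    have hratio : (1 + 2 * (n : ℝ)) * riccatiCoeff v (n + 1) ≤ riccatiCoeff v (n + 2) := by
      have hrec := riccatiCoeff_succ v (n + 1)
      push_cast at hrec
      refine le_of_mul_le_mul_left ?_ (show (0 : ℝ) < 2 * (n + 1 + 1) by positivity)
      rw [hrec, ← mul_assoc]
      refine mul_le_mul_of_nonneg_right ?_ g1.le
      have hn : (0 : ℝ) ≤ n := Nat.cast_nonneg n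
      nlinarith [mul_nonneg hn hv.le]
    refine le_trans ?_ (div_le_div_of_nonneg_right (low n) hp.le)
    have e1 : v * riccatiCoeff v (n + 2) / ((v + 2 * (n + 2 : ℕ)) * riccatiCoeff v (n + 2)) =
        v / (v + 4 + 2 * n) := by
      rw [mul_div_mul_right _ _ g2.ne']
      push_cast
      ring_nf
    have e2 : (v + 2 * (n + 2 : ℕ)) * (K * riccatiCoeff v (n + 1)) /
        ((v + 2 * (n + 2 : ℕ)) * riccatiCoeff v (n + 2)) ≤ K / (1 + 2 * n) := by
      rw [mul_div_mul_left _ _ (by positivity), div_le_div_iff₀ g2 (by positivity)]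
      nlinarith [mul_le_mul_of_nonneg_left hratio Knn]
    rw [sub_div, sub_div, div_self hp.ne', e1]
    linarith
  · intro n
    have g2 := gpos (n + 2)
    exact (div_le_one (by positivity)).2 (yle _)

/-- Euler's limit formula for `Γ`, as a statement on the ratio of the leading terms. -/
lemma tendsto_riccatiCoeff_ratio {v : ℝ} (hv : 0 < v) :
    Tendsto (fun n : ℕ => (n : ℝ) ^ (1 - v) *
      (((v + 2 * n) * riccatiCoeff v n) / ((1 + 2 * n) * riccatiCoeff 1 n))) atTop
      (nhds ((2 : ℝ) ^ (v - 1) / Real.Gamma v)) := by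
  have hG : Tendsto (fun n : ℕ => Real.GammaSeq v (2 * n)) atTop (nhds (Real.Gamma v)) :=
    (Real.GammaSeq_tendsto_Gamma v).comp (tendsto_id.const_mul_atTop' two_pos)
  have hr : Tendsto (fun n : ℕ => 1 - 1 / (1 + 2 * (n : ℝ))) atTop (nhds 1) := by
    have : Tendsto (fun n : ℕ => 1 / (1 + 2 * (n : ℝ))) atTop (nhds 0) :=
      Tendsto.const_div_atTop (tendsto_atTop_add_const_left _ _
        (tendsto_natCast_atTop_atTop.const_mul_atTop two_pos)) _
    simpa using tendsto_const_nhds.sub this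
  have hlim := (hr.const_mul ((2 : ℝ) ^ (v - 1))).div hG (Real.Gamma_pos_of_pos hv).ne'
  rw [mul_one] at hlim
  refine hlim.congr' ?_
  filter_upwards [eventually_gt_atTop 0] with n hn
  have hn' : (0 : ℝ) < n := by exact_mod_cast hn
  have hone : ∏ j ∈ Finset.range (2 * n), ((1 : ℝ) + j) = (2 * n).factorial := by
    rw [← Finset.prod_range_add_one_eq_factorial]
    push_cast
    exact Finset.prod_congr rfl fun j _ => add_comm _ _
  have hP : 0 < ∏ j ∈ Finset.range (2 * n), (v + j) := Finset.prod_pos fun j _ => by positivity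
  have hf : (0 : ℝ) < (2 * n).factorial := by exact_mod_cast (2 * n).factorial_pos
  have hf' : (0 : ℝ) < n.factorial := by exact_mod_cast n.factorial_pos
  simp only [Pi.div_apply, Real.GammaSeq, riccatiCoeff, hone, Finset.prod_range_succ]
  push_cast
  rw [Real.mul_rpow two_pos.le hn'.le, Real.rpow_sub two_pos, Real.rpow_sub hn', Real.rpow_one,
    Real.rpow_one]
  have h2v : (0 : ℝ) < 2 ^ v := by positivity
  have hnv : (0 : ℝ) < (n : ℝ) ^ v := by positivity
  field_simp
  ring

/-- For every fixed real `v > 0`,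
`lim_{n→∞} n^{1−v} · x_n(v)/x_n(1) = 2^{v−1}/Γ(v)`: the probability generating
function of the number of vertices of a uniform random rooted map with `n` edges
satisfies `E(v^{X_n}) = (2^{v−1}/Γ(v))·n^{v−1}·(1 + o(1))`. -/
theorem vertices_pgf_asymptotics
    (x : ℕ → Polynomial ℝ) (hx0 : x 0 = X)
    (hx : ∀ n : ℕ, x (n + 1) =
      C (2 * ((n : ℝ) + 1) - 1) * x n + ∑ i ∈ Finset.range (n + 1), x i * x (n - i)) :
    ∀ v : ℝ, 0 < v →
      Tendsto (fun n : ℕ => (n : ℝ) ^ (1 - v) * ((x n).eval v / (x n).eval 1)) atTop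
        (nhds ((2 : ℝ) ^ (v - 1) / Real.Gamma v)) := by
  intro v hv
  have hmain {w : ℝ} (hw : 0 < w) :
      Tendsto (fun n : ℕ => (x n).eval w / ((w + 2 * n) * riccatiCoeff w n)) atTop (nhds 1) := by
    refine tendsto_div_riccatiCoeff hw (by simp [hx0]) fun n => ?_
    rw [hx]
    simp only [eval_add, eval_mul, eval_C, eval_finsetSum]
  have hlim := (tendsto_riccatiCoeff_ratio hv).mul ((hmain hv).div (hmain one_pos) one_ne_zero)
  rw [div_one, mul_one] at hlim
  refine hlim.congr fun n => ?_
  have gv := riccatiCoeff_pos hv n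
  have g1 := riccatiCoeff_pos one_pos n
  have hv' : v + 2 * (n : ℝ) ≠ 0 := by positivity
  have h1' : 1 + 2 * (n : ℝ) ≠ 0 := by positivity
  simp only [Pi.div_apply]
  field_simp
end

section
/- Let X_n be the number of vertices of a uniform random rooted map with n edges, i.e. P(X_n = k) = x_{n,k}/x_n(1). Then its mean E(X_n) = x_n′(1)/x_n(1) and variance Var(X_n) = x_n″(1)/x_n(1) + E(X_n) − E(X_n)² satisfy lim_{n→∞} E(X_n)/log n = 1 and lim_{n→∞} Var(X_n)/log n = 1. -/
open Polynomial Filter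

theorem sum_range_succ_eq_ends_add_Ico {n : ℕ} (hn : 1 ≤ n) (f : ℕ → ℝ) :
    ∑ i ∈ Finset.range (n + 1), f i = f 0 + f n + ∑ i ∈ Finset.Ico 1 n, f i := by
  rw [Finset.sum_range_succ, Finset.range_eq_Ico, Finset.sum_eq_sum_Ico_succ_bot (by omega)]
  ring

section MapCount

variable {m : ℕ → ℝ}

/-- The recurrence with the two extreme terms of the convolution separated. -/
theorem mapCount_succ (h0 : m 0 = 1)
    (h : ∀ n : ℕ, m (n + 1) =
      (2 * ((n : ℝ) + 1) - 1) * m n + ∑ i ∈ Finset.range (n + 1), m i * m (n - i))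
    {n : ℕ} (hn : 1 ≤ n) :
    m (n + 1) = (2 * n + 3) * m n + ∑ i ∈ Finset.Ico 1 n, m i * m (n - i) := by
  rw [h, sum_range_succ_eq_ends_add_Ico hn]
  simp only [h0, Nat.sub_zero, Nat.sub_self]
  ring

theorem mapCount_pos (h0 : m 0 = 1)
    (h : ∀ n : ℕ, m (n + 1) =
      (2 * ((n : ℝ) + 1) - 1) * m n + ∑ i ∈ Finset.range (n + 1), m i * m (n - i)) (n : ℕ) :
    0 < m n := by
  induction n using Nat.strong_induction_on with
  | _ n ih =>
    rcases n with _ | n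
    · simp [h0]
    · rw [h]
      have h1 : 0 ≤ ∑ i ∈ Finset.range (n + 1), m i * m (n - i) :=
        Finset.sum_nonneg fun i hi => by
          have hi := Finset.mem_range.1 hi
          exact (mul_pos (ih i hi) (ih (n - i) (by omega))).le
      have h2 : 0 < (2 * ((n : ℝ) + 1) - 1) * m n :=
        mul_pos (by have := n.cast_nonneg (α := ℝ); linarith) (ih n (by omega))
      linarith

/-- A sequence whose successive ratios increase satisfies `m (c + a) m (c + b) ≤ m c m (c+a+b)`. -/
theorem mul_le_mul_of_ratio_bounds (hpos : ∀ n, 0 < m n) {N c : ℕ} (hc : 1 ≤ c)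
    (hlo : ∀ k, 1 ≤ k → k < N → (2 * (k : ℝ) + 3) * m k ≤ m (k + 1))
    (hhi : ∀ k, 1 ≤ k → k < N → m (k + 1) ≤ (2 * (k : ℝ) + 4) * m k)
    (a b : ℕ) (hab : c + a + b ≤ N) : m (c + a) * m (c + b) ≤ m c * m (c + a + b) := by
  rcases Nat.eq_zero_or_pos b with rfl | hb
  · exact (mul_comm _ _).le
  induction a with
  | zero => simp
  | succ a ih =>
    have h1 := hhi (c + a) (by omega) (by omega)
    have h2 := hlo (c + a + b) (by omega) (by omega)
    have h3 := ih (by omega)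
    have hb' : (1 : ℝ) ≤ b := by exact_mod_cast hb
    have e : c + (a + 1) + b = c + a + b + 1 := by omega
    rw [e, ← add_assoc]
    push_cast at h1 h2
    have hca : (0 : ℝ) ≤ 2 * (c + a) + 4 := by positivity
    calc m (c + a + 1) * m (c + b) ≤ ((2 * (c + a) + 4) * m (c + a)) * m (c + b) := by
          have := (hpos (c + b)).le
          gcongr
      _ = (2 * (c + a) + 4) * (m (c + a) * m (c + b)) := by ring
      _ ≤ (2 * (c + a) + 4) * (m c * m (c + a + b)) := by gcongr
      _ = m c * ((2 * (c + a) + 4) * m (c + a + b)) := by ring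
      _ ≤ m c * ((2 * (c + a + b) + 3) * m (c + a + b)) := by
          have := (hpos c).le
          have := (hpos (c + a + b)).le
          gcongr ?_ * (?_ * _)
          linarith
      _ ≤ m c * m (c + a + b + 1) := by
          have := (hpos c).le
          gcongr

theorem mapCount_ratio_bounds (h0 : m 0 = 1)
    (h : ∀ n : ℕ, m (n + 1) =
      (2 * ((n : ℝ) + 1) - 1) * m n + ∑ i ∈ Finset.range (n + 1), m i * m (n - i))
    (n : ℕ) (hn : 1 ≤ n) :
    (2 * (n : ℝ) + 3) * m n ≤ m (n + 1) ∧ m (n + 1) ≤ (2 * (n : ℝ) + 4) * m n := by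
  have hpos := mapCount_pos h0 h
  have hm1 : m 1 = 2 := by norm_num [h 0, h0]
  induction n using Nat.strong_induction_on with
  | _ n ih =>
    rw [mapCount_succ h0 h hn]
    have hS0 : 0 ≤ ∑ i ∈ Finset.Ico 1 n, m i * m (n - i) :=
      Finset.sum_nonneg fun i _ => (mul_pos (hpos _) (hpos _)).le
    refine ⟨by linarith, ?_⟩
    suffices hS : ∑ i ∈ Finset.Ico 1 n, m i * m (n - i) ≤ m n by linarith
    have hterm : ∀ i ∈ Finset.Ico 1 n, m i * m (n - i) ≤ 2 * m (n - 1) := by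
      intro i hi
      obtain ⟨hi1, hi2⟩ := Finset.mem_Ico.1 hi
      have := mul_le_mul_of_ratio_bounds hpos (N := n) (c := 1) le_rfl
        (fun k h1 h2 => (ih k h2 h1).1) (fun k h1 h2 => (ih k h2 h1).2) (i - 1) (n - i - 1)
        (by omega)
      rwa [hm1, show 1 + (i - 1) = i by omega, show 1 + (n - i - 1) = n - i by omega,
        show i + (n - i - 1) = n - 1 by omega] at this
    have hsum := Finset.sum_le_card_nsmul _ _ _ hterm
    rw [Nat.card_Ico, nsmul_eq_mul] at hsum
    rcases hn.eq_or_lt with rfl | hn1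
    · simp [hm1]
    · obtain ⟨k, rfl⟩ : ∃ k, n = k + 1 := ⟨n - 1, by omega⟩
      have h1 := (ih k (by omega) (by omega)).1
      have h2 := hpos k
      simp only [Nat.add_sub_cancel] at hsum
      linarith

theorem mapCount_sum_Ico_le (h0 : m 0 = 1)
    (h : ∀ n : ℕ, m (n + 1) =
      (2 * ((n : ℝ) + 1) - 1) * m n + ∑ i ∈ Finset.range (n + 1), m i * m (n - i))
    (n : ℕ) (hn : 1 ≤ n) :
    (∑ i ∈ Finset.Ico 1 n, m i * m (n - i)) / m (n + 1) ≤ 14 / ((n : ℝ) + 1) ^ 2 := by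
  have hpos := mapCount_pos h0 h
  have hr := mapCount_ratio_bounds h0 h
  have hm1 : m 1 = 2 := by norm_num [h 0, h0]
  have hm2 : m 2 = 10 := by rw [h 1]; simp [h0, hm1, Finset.sum_range_succ]; norm_num
  rcases hn.eq_or_lt with rfl | hn1
  · simp; positivity
  obtain ⟨k, rfl⟩ : ∃ k, n = k + 2 := ⟨n - 2, by omega⟩
  have hterm : ∀ i ∈ Finset.Ico 1 (k + 2), m i * m (k + 2 - i) ≤
      10 * m k + ((if i = 1 then 2 * m (k + 1) else 0) +
        if i = k + 1 then 2 * m (k + 1) else 0) := by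
    intro i hi
    obtain ⟨hi1, hi2⟩ := Finset.mem_Ico.1 hi
    have p1 := hpos k
    have p2 := hpos (k + 1)
    by_cases e1 : i = 1
    · subst e1
      have : k + 2 - 1 = k + 1 := by omega
      rw [this, hm1]
      split_ifs <;> first | linarith | omega
    by_cases e2 : i = k + 1
    · subst e2
      have : k + 2 - (k + 1) = 1 := by omega
      rw [this, hm1]
      split_ifs <;> first | linarith | omega
    rw [if_neg e1, if_neg e2]
    have := mul_le_mul_of_ratio_bounds hpos (N := k + 2) (c := 2) (by norm_num)
        (fun k h1 _ => (hr k h1).1) (fun k h1 _ => (hr k h1).2) (i - 2) (k + 2 - i - 2)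
        (by omega)
    rw [hm2, show 2 + (i - 2) = i by omega, show 2 + (k + 2 - i - 2) = k + 2 - i by omega,
      show i + (k + 2 - i - 2) = k by omega] at this
    linarith
  have hsum := Finset.sum_le_sum hterm
  have hS : ∑ i ∈ Finset.Ico 1 (k + 2), m i * m (k + 2 - i) ≤ 14 * m (k + 1) := by
    refine hsum.trans ?_
    rw [Finset.sum_add_distrib, Finset.sum_add_distrib, Finset.sum_ite_eq', Finset.sum_ite_eq',
      if_pos (by simp), if_pos (by simp), Finset.sum_const, Nat.card_Ico, nsmul_eq_mul]
    have hk : ((k : ℝ) + 1) * m k ≤ m (k + 1) := by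
      rcases Nat.eq_zero_or_pos k with rfl | hk
      · simp [h0, hm1]
      · have := (hr k hk).1
        have := hpos k
        nlinarith
    simp only [show k + 2 - 1 = k + 1 by omega]
    push_cast
    linarith
  rw [div_le_div_iff₀ (hpos _) (by positivity)]
  have r1 := (hr (k + 1) (by omega)).1
  have r2 := (hr (k + 2) (by omega)).1
  push_cast at r1 r2 ⊢
  have p2 := hpos (k + 1)
  have hk : (0 : ℝ) ≤ k := k.cast_nonneg
  have key : ((k : ℝ) + 2 + 1) ^ 2 * m (k + 1) ≤ m (k + 2 + 1) := by
    calc ((k : ℝ) + 2 + 1) ^ 2 * m (k + 1)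
        ≤ (2 * (k + 2) + 3) * ((2 * (k + 1) + 3) * m (k + 1)) := by
          rw [← mul_assoc]
          gcongr
          nlinarith
      _ ≤ (2 * (k + 2) + 3) * m (k + 2) := by gcongr
      _ ≤ m (k + 2 + 1) := r2
  calc (∑ i ∈ Finset.Ico 1 (k + 2), m i * m (k + 2 - i)) * ((k : ℝ) + 2 + 1) ^ 2
      ≤ 14 * m (k + 1) * ((k : ℝ) + 2 + 1) ^ 2 := by gcongr
    _ ≤ 14 * m (k + 2 + 1) := by linarith

theorem tendsto_mapCount_ratio (h0 : m 0 = 1)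
    (h : ∀ n : ℕ, m (n + 1) =
      (2 * ((n : ℝ) + 1) - 1) * m n + ∑ i ∈ Finset.range (n + 1), m i * m (n - i)) :
    Tendsto (fun n : ℕ => ((n : ℝ) + 1) * (2 * m n / m (n + 1))) atTop (nhds 1) := by
  have hpos := mapCount_pos h0 h
  have hr := mapCount_ratio_bounds h0 h
  have hlim : Tendsto (fun n : ℕ => 1 - 1 / ((n : ℝ) + 1)) atTop (nhds 1) := by
    simpa using tendsto_const_nhds.sub (tendsto_one_div_add_atTop_nhds_zero_nat (𝕜 := ℝ))
  refine tendsto_of_tendsto_of_tendsto_of_le_of_le' hlim tendsto_const_nhds ?_ ?_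
  · filter_upwards [eventually_ge_atTop 1] with n hn
    have h1 := (hr n hn).2
    have p := hpos n
    have hn0 : (0 : ℝ) ≤ n := n.cast_nonneg
    have : 1 / ((n : ℝ) + 2) ≤ 2 * m n / m (n + 1) := by
      rw [div_le_div_iff₀ (by positivity) (hpos _)]
      linarith
    calc 1 - 1 / ((n : ℝ) + 1) ≤ (n + 1) * (1 / (n + 2)) := by
          rw [← sub_nonneg]
          have : ((n : ℝ) + 1) * (1 / (n + 2)) - (1 - 1 / (n + 1)) =
            1 / ((n + 1) * (n + 2)) := by field_simp; ring
          rw [this]; positivity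
      _ ≤ _ := by gcongr
  · filter_upwards [eventually_ge_atTop 1] with n hn
    have h1 := (hr n hn).1
    have p := hpos n
    rw [← mul_div_assoc, div_le_one (hpos _)]
    linarith

end MapCount

section LogGrowth

/-- The real-valued majorant `1 + H_n` used for sequences of logarithmic growth. -/
noncomputable def oneAddHarmonic (n : ℕ) : ℝ := 1 + ∑ i ∈ Finset.range n, 1 / ((i : ℝ) + 1)

theorem one_le_oneAddHarmonic (n : ℕ) : 1 ≤ oneAddHarmonic n := by
  have : 0 ≤ ∑ i ∈ Finset.range n, 1 / ((i : ℝ) + 1) := Finset.sum_nonneg fun i _ => by positivity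
  unfold oneAddHarmonic
  linarith

theorem oneAddHarmonic_succ (n : ℕ) :
    oneAddHarmonic (n + 1) = oneAddHarmonic n + 1 / ((n : ℝ) + 1) := by
  simp [oneAddHarmonic, Finset.sum_range_succ, add_assoc]

theorem oneAddHarmonic_mono : Monotone oneAddHarmonic :=
  monotone_nat_of_le_succ fun n => by
    rw [oneAddHarmonic_succ]
    have : (0 : ℝ) ≤ 1 / ((n : ℝ) + 1) := by positivity
    linarith

theorem cast_harmonic_eq_sum (n : ℕ) :
    (harmonic n : ℝ) = ∑ i ∈ Finset.range n, 1 / ((i : ℝ) + 1) := by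
  simp [harmonic]

theorem tendsto_log_natCast_atTop : Tendsto (fun n : ℕ => Real.log n) atTop atTop :=
  Real.tendsto_log_atTop.comp tendsto_natCast_atTop_atTop

theorem tendsto_sum_one_div_div_log :
    Tendsto (fun n : ℕ => (∑ i ∈ Finset.range n, 1 / ((i : ℝ) + 1)) / Real.log n) atTop
      (nhds 1) := by
  have h1 := Real.tendsto_harmonic_sub_log.div_atTop tendsto_log_natCast_atTop
  have h2 := h1.const_add 1
  rw [add_zero] at h2
  refine h2.congr' ?_
  filter_upwards [tendsto_log_natCast_atTop.eventually_gt_atTop 0] with n hn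
  rw [cast_harmonic_eq_sum]
  field_simp
  ring

theorem tendsto_oneAddHarmonic_sq_div :
    Tendsto (fun n : ℕ => oneAddHarmonic n ^ 2 / ((n : ℝ) + 1)) atTop (nhds 0) := by
  have h1 : Tendsto (fun n : ℕ => oneAddHarmonic n / Real.log n) atTop (nhds 1) := by
    have := (tendsto_const_nhds (x := (1 : ℝ))).div_atTop tendsto_log_natCast_atTop |>.add
      tendsto_sum_one_div_div_log
    rw [zero_add] at this
    exact this.congr fun n => by rw [oneAddHarmonic, add_div]
  have h2 : Tendsto (fun n : ℕ => Real.log n ^ 2 / (n : ℝ)) atTop (nhds 0) :=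
    ((Real.isLittleO_pow_log_id_atTop (n := 2)).tendsto_div_nhds_zero).comp
      tendsto_natCast_atTop_atTop
  have h3 : Tendsto (fun n : ℕ => (n : ℝ) / ((n : ℝ) + 1)) atTop (nhds 1) :=
    tendsto_natCast_div_add_atTop 1
  have h4 := ((h1.pow 2).mul h2).mul h3
  simp only [mul_zero, zero_mul] at h4
  refine h4.congr' ?_
  filter_upwards [tendsto_log_natCast_atTop.eventually_gt_atTop 0, eventually_gt_atTop 0]
    with n hn hn0
  have : (n : ℝ) ≠ 0 := by positivity
  field_simp

theorem tendsto_oneAddHarmonic_div :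
    Tendsto (fun n : ℕ => oneAddHarmonic n / ((n : ℝ) + 1)) atTop (nhds 0) := by
  refine squeeze_zero (fun n => ?_) (fun n => ?_) tendsto_oneAddHarmonic_sq_div
  · have := one_le_oneAddHarmonic n
    positivity
  · have := one_le_oneAddHarmonic n
    gcongr
    nlinarith

theorem tendsto_div_log_of_tendsto_mul_sub {u : ℕ → ℝ}
    (hu : Tendsto (fun n : ℕ => ((n : ℝ) + 1) * (u (n + 1) - u n)) atTop (nhds 1)) :
    Tendsto (fun n : ℕ => u n / Real.log n) atTop (nhds 1) := by
  have ho : (fun n : ℕ => u (n + 1) - u n - 1 / ((n : ℝ) + 1)) =o[atTop]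
      fun n : ℕ => 1 / ((n : ℝ) + 1) := by
    rw [Asymptotics.isLittleO_iff_tendsto fun n hn => absurd hn (by positivity)]
    have := hu.sub_const 1
    rw [sub_self] at this
    refine this.congr fun n => ?_
    field_simp
  have hs := ho.sum_range (fun n => by positivity) Real.tendsto_sum_range_one_div_nat_succ_atTop
  have hdiv := hs.tendsto_div_nhds_zero.mul tendsto_sum_one_div_div_log
  have h0 := (tendsto_const_nhds (x := u 0)).div_atTop tendsto_log_natCast_atTop
  have := (hdiv.add h0).add tendsto_sum_one_div_div_log
  simp only [zero_mul, zero_add] at this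
  refine this.congr' ?_
  filter_upwards [tendsto_log_natCast_atTop.eventually_gt_atTop 0, eventually_gt_atTop 0]
    with n hn hn0
  have hpos : 0 < ∑ i ∈ Finset.range n, 1 / ((i : ℝ) + 1) :=
    Finset.sum_pos (fun i _ => by positivity) ⟨0, by simpa using hn0⟩
  rw [Finset.sum_sub_distrib, Finset.sum_range_sub]
  field_simp
  ring

variable {u d : ℕ → ℝ} {C : ℝ}

theorem exists_abs_le_oneAddHarmonic (hC : 0 ≤ C)
    (hd : Tendsto (fun n : ℕ => ((n : ℝ) + 1) * d n) atTop (nhds 1))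
    (hu : ∀ n, 1 ≤ n → ∀ M, (∀ k ≤ n, |u k| ≤ M) →
      |u (n + 1) - u n - d n| ≤ C / ((n : ℝ) + 1) ^ 2 * M) :
    ∃ K, 0 ≤ K ∧ ∀ n, |u n| ≤ K * oneAddHarmonic n := by
  obtain ⟨D₀, hD₀⟩ := hd.abs.bddAbove_range
  have hD : ∀ n : ℕ, |d n| ≤ D₀ / ((n : ℝ) + 1) := fun n => by
    have := hD₀ ⟨n, rfl⟩
    simp only [abs_mul] at this
    rw [abs_of_pos (by positivity : (0 : ℝ) < (n : ℝ) + 1)] at this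
    rw [le_div_iff₀ (by positivity)]
    linarith
  set B : ℝ := |u 0| + |u 1| + |D₀| with hB
  have hB0 : 0 ≤ B := by positivity
  set w : ℕ → ℝ := fun n => Real.exp (2 * C - 2 * C / ((n : ℝ) + 1)) with hw
  have hw1 : ∀ n, 1 ≤ w n := fun n => by
    refine Real.one_le_exp (sub_nonneg.2 (div_le_self (by positivity) ?_))
    have := n.cast_nonneg (α := ℝ)
    linarith
  have hwstep : ∀ n, w n * (1 + C / ((n : ℝ) + 1) ^ 2) ≤ w (n + 1) := fun n => by
    have e1 : C / ((n : ℝ) + 1) ^ 2 ≤ 2 * C / ((n + 1) * (n + 2)) := by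
      rw [div_le_div_iff₀ (by positivity) (by positivity)]
      have := n.cast_nonneg (α := ℝ)
      have : 0 ≤ C * (((n : ℝ) + 1) * n) := by positivity
      nlinarith
    have e2 := Real.add_one_le_exp (2 * C / (((n : ℝ) + 1) * (n + 2)))
    have e3 : w (n + 1) = w n * Real.exp (2 * C / (((n : ℝ) + 1) * (n + 2))) := by
      simp only [hw]
      rw [← Real.exp_add]
      congr 1
      push_cast
      field_simp
      ring
    rw [e3]
    have := hw1 n
    gcongr
    linarith
  have hwmono : Monotone w := monotone_nat_of_le_succ fun n => by
    refine le_trans ?_ (hwstep n)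
    have := hw1 n
    have : 0 ≤ C / ((n : ℝ) + 1) ^ 2 := by positivity
    nlinarith
  have main : ∀ n, |u n| ≤ w n * (B * oneAddHarmonic n) := by
    intro n
    induction n using Nat.strong_induction_on with
    | _ n ih =>
      have base : B ≤ w n * (B * oneAddHarmonic n) := by
        have h1 := hw1 n
        have h2 := one_le_oneAddHarmonic n
        have h3 : B ≤ B * oneAddHarmonic n := le_mul_of_one_le_right hB0 h2
        exact h3.trans (le_mul_of_one_le_left (hB0.trans h3) h1)
      have := abs_nonneg (u 0)
      have := abs_nonneg (u 1)
      have := abs_nonneg D₀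
      rcases n with _ | _ | n
      · linarith
      · rw [zero_add] at *
        linarith
      set k := n + 1 with hk
      have hM : ∀ j ≤ k, |u j| ≤ w k * (B * oneAddHarmonic k) := fun j hj => by
        refine (ih j (by omega)).trans ?_
        have h1 := hwmono hj
        have h2 := oneAddHarmonic_mono hj
        have h3 := one_le_oneAddHarmonic j
        have h4 := hw1 j
        gcongr
      have h1 := hu k (by omega) _ hM
      have h2 := hM k le_rfl
      have h3 := hD k
      have h4 : |u (k + 1)| ≤ |u (k + 1) - u k - d k| + |u k| + |d k| := by
        have := abs_add_three (u (k + 1) - u k - d k) (u k) (d k)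
        rwa [show u (k + 1) - u k - d k + u k + d k = u (k + 1) by ring] at this
      have h5 : D₀ / ((k : ℝ) + 1) ≤ w (k + 1) * (B * (1 / ((k : ℝ) + 1))) := by
        have hDB : D₀ ≤ B := by
          have := le_abs_self D₀
          linarith
        have h6 : D₀ / ((k : ℝ) + 1) ≤ B * (1 / ((k : ℝ) + 1)) := by
          rw [mul_one_div]; gcongr
        exact h6.trans (le_mul_of_one_le_left (by positivity) (hw1 _))
      have h7 : w k * (1 + C / ((k : ℝ) + 1) ^ 2) * (B * oneAddHarmonic k) ≤
          w (k + 1) * (B * oneAddHarmonic k) := by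
        have := one_le_oneAddHarmonic k
        gcongr
        exact hwstep k
      rw [oneAddHarmonic_succ]
      linarith
  refine ⟨Real.exp (2 * C) * B, by positivity, fun n => (main n).trans ?_⟩
  have := one_le_oneAddHarmonic n
  rw [mul_assoc]
  gcongr
  simp only [hw]
  gcongr
  have : 0 ≤ 2 * C / ((n : ℝ) + 1) := by positivity
  linarith

theorem tendsto_mul_sub_of_perturbed_increment
    (hd : Tendsto (fun n : ℕ => ((n : ℝ) + 1) * d n) atTop (nhds 1))
    (hu : ∀ n, 1 ≤ n → ∀ M, (∀ k ≤ n, |u k| ≤ M) →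
      |u (n + 1) - u n - d n| ≤ C / ((n : ℝ) + 1) ^ 2 * M)
    {K : ℝ} (hK0 : 0 ≤ K) (hK : ∀ n, |u n| ≤ K * oneAddHarmonic n) :
    Tendsto (fun n : ℕ => ((n : ℝ) + 1) * (u (n + 1) - u n)) atTop (nhds 1) := by
  have herr : Tendsto (fun n : ℕ => ((n : ℝ) + 1) * (u (n + 1) - u n - d n)) atTop (nhds 0) := by
    have hlim := tendsto_oneAddHarmonic_div.const_mul (C * K)
    rw [mul_zero] at hlim
    refine squeeze_zero_norm' ?_ hlim
    filter_upwards [eventually_ge_atTop 1] with n hn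
    have := hu n hn (K * oneAddHarmonic n) fun k hk =>
      (hK k).trans (mul_le_mul_of_nonneg_left (oneAddHarmonic_mono hk) hK0)
    rw [Real.norm_eq_abs, abs_mul, abs_of_pos (by positivity : (0 : ℝ) < (n : ℝ) + 1)]
    calc ((n : ℝ) + 1) * |u (n + 1) - u n - d n|
        ≤ ((n : ℝ) + 1) * (C / ((n : ℝ) + 1) ^ 2 * (K * oneAddHarmonic n)) := by gcongr
      _ = C * K * (oneAddHarmonic n / (n + 1)) := by field_simp
  have := herr.add hd
  rw [zero_add] at this
  exact this.congr fun n => by ring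

end LogGrowth

theorem abs_weighted_sum_le {s : Finset ℕ} {w f : ℕ → ℝ} {B : ℝ} (hw : ∀ i ∈ s, 0 ≤ w i)
    (hf : ∀ i ∈ s, |f i| ≤ B) : |∑ i ∈ s, w i * f i| ≤ (∑ i ∈ s, w i) * B := by
  rw [Finset.sum_mul]
  refine (Finset.abs_sum_le_sum_abs _ _).trans (Finset.sum_le_sum fun i hi => ?_)
  rw [abs_mul, abs_of_nonneg (hw i hi)]
  exact mul_le_mul_of_nonneg_left (hf i hi) (hw i hi)

/-- The mean `E(X_n) = x_n′(1)/x_n(1)` and variance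
`Var(X_n) = x_n″(1)/x_n(1) + E(X_n) − E(X_n)²` of the number of vertices of a uniform
random rooted map with `n` edges are both asymptotic to `log n`. -/
theorem vertices_mean_variance
    (x : ℕ → Polynomial ℝ) (hx0 : x 0 = X)
    (hx : ∀ n : ℕ, x (n + 1) =
      C (2 * ((n : ℝ) + 1) - 1) * x n + ∑ i ∈ Finset.range (n + 1), x i * x (n - i))
    (E V : ℕ → ℝ)
    (hE : ∀ n, E n = (derivative (x n)).eval 1 / (x n).eval 1)
    (hV : ∀ n, V n = (derivative (derivative (x n))).eval 1 / (x n).eval 1 + E n - (E n) ^ 2) :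
    Tendsto (fun n : ℕ => E n / Real.log n) atTop (nhds 1) ∧
      Tendsto (fun n : ℕ => V n / Real.log n) atTop (nhds 1) := by
  set m : ℕ → ℝ := fun n => (x n).eval 1 with hm
  have h0 : m 0 = 1 := by simp [hm, hx0]
  have h : ∀ n : ℕ, m (n + 1) =
      (2 * ((n : ℝ) + 1) - 1) * m n + ∑ i ∈ Finset.range (n + 1), m i * m (n - i) := fun n => by
    simp only [hm]
    rw [hx, eval_add, eval_mul, eval_C, eval_finsetSum]
    simp only [eval_mul]
  have hpos := mapCount_pos h0 h
  have hE' : ∀ n, (derivative (x n)).eval 1 = m n * E n := fun n => by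
    rw [hE, mul_div_cancel₀ _ (hpos n).ne']
  have hV' : ∀ n, (derivative (derivative (x n))).eval 1 = m n * (V n - E n + E n ^ 2) :=
    fun n => by
      have : (derivative (derivative (x n))).eval 1 / m n = V n - E n + E n ^ 2 := by
        rw [hV]
        ring
      rw [← this, mul_div_cancel₀ _ (hpos n).ne']
  have hE0 : E 0 = 1 := by simp [hE, hx0]
  have hV0 : V 0 = 0 := by simp [hV, hx0, hE0]
  have hErec : ∀ n : ℕ, m (n + 1) * E (n + 1) = (2 * ((n : ℝ) + 1) - 1) * (m n * E n) +
      ∑ i ∈ Finset.range (n + 1), m i * m (n - i) * (E i + E (n - i)) := fun n => by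
    rw [← hE', hx, derivative_add, derivative_C_mul, derivative_sum, eval_add, eval_mul, eval_C,
      eval_finsetSum, hE']
    congr 1
    refine Finset.sum_congr rfl fun i _ => ?_
    rw [derivative_mul, eval_add, eval_mul, eval_mul, hE', hE']
    ring
  have hVrec : ∀ n : ℕ, m (n + 1) * (V (n + 1) + E (n + 1) ^ 2) =
      (2 * ((n : ℝ) + 1) - 1) * (m n * (V n + E n ^ 2)) +
      ∑ i ∈ Finset.range (n + 1),
        m i * m (n - i) * (V i + V (n - i) + (E i + E (n - i)) ^ 2) := fun n => by
    have key : m (n + 1) * (V (n + 1) - E (n + 1) + E (n + 1) ^ 2) =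
        (2 * ((n : ℝ) + 1) - 1) * (m n * (V n - E n + E n ^ 2)) +
        ∑ i ∈ Finset.range (n + 1), m i * m (n - i) *
          (V i + V (n - i) + (E i + E (n - i)) ^ 2 - (E i + E (n - i))) := by
      rw [← hV', hx, derivative_add, derivative_C_mul, derivative_sum, derivative_add,
        derivative_C_mul, derivative_sum, eval_add, eval_mul, eval_C, eval_finsetSum, hV']
      congr 1
      refine Finset.sum_congr rfl fun i _ => ?_
      simp only [derivative_mul, derivative_add, eval_add, eval_mul, hE', hV']
      simp only [hm]
      ring
    simp only [mul_sub _ _ (E _ + E _), Finset.sum_sub_distrib] at key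
    linarith [hErec n]
  -- Increments, with the extreme terms of the convolutions separated.
  have hEinc : ∀ n, 1 ≤ n → E (n + 1) - E n - 2 * m n / m (n + 1) =
      (∑ i ∈ Finset.Ico 1 n, m i * m (n - i) * (E i + E (n - i) - E n)) / m (n + 1) :=
    fun n hn => by
      have h1 := hErec n
      have h2 := mapCount_succ h0 h hn
      rw [sum_range_succ_eq_ends_add_Ico hn] at h1
      simp only [Nat.sub_zero, Nat.sub_self, h0, hE0] at h1
      rw [eq_div_iff (hpos _).ne', sub_mul, div_mul_cancel₀ _ (hpos _).ne']
      simp only [mul_sub, Finset.sum_sub_distrib, ← Finset.sum_mul]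
      linear_combination h1 - E n * h2
  have hVinc : ∀ n, 1 ≤ n → V (n + 1) - V n - (2 * m n / m (n + 1) +
      ((∑ i ∈ Finset.Ico 1 n, m i * m (n - i) * (E i + E (n - i) - E n) ^ 2) / m (n + 1) -
        (E (n + 1) - E n) ^ 2)) =
      (∑ i ∈ Finset.Ico 1 n, m i * m (n - i) * (V i + V (n - i) - V n)) / m (n + 1) :=
    fun n hn => by
      have h1 := hErec n
      have h2 := mapCount_succ h0 h hn
      have h3 := hVrec n
      rw [sum_range_succ_eq_ends_add_Ico hn] at h1 h3
      simp only [Nat.sub_zero, Nat.sub_self, h0, hE0, hV0] at h1 h3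
      have e1 : ∑ i ∈ Finset.Ico 1 n, m i * m (n - i) * (E i + E (n - i) - E n) ^ 2 =
          ∑ i ∈ Finset.Ico 1 n, m i * m (n - i) * (V i + V (n - i) + (E i + E (n - i)) ^ 2) -
          ∑ i ∈ Finset.Ico 1 n, m i * m (n - i) * (V i + V (n - i)) -
          2 * E n * ∑ i ∈ Finset.Ico 1 n, m i * m (n - i) * (E i + E (n - i)) +
          E n ^ 2 * ∑ i ∈ Finset.Ico 1 n, m i * m (n - i) := by
        rw [Finset.mul_sum, Finset.mul_sum, ← Finset.sum_sub_distrib, ← Finset.sum_sub_distrib,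
          ← Finset.sum_add_distrib]
        exact Finset.sum_congr rfl fun i _ => by ring
      have e2 : ∑ i ∈ Finset.Ico 1 n, m i * m (n - i) * (V i + V (n - i) - V n) =
          ∑ i ∈ Finset.Ico 1 n, m i * m (n - i) * (V i + V (n - i)) -
          V n * ∑ i ∈ Finset.Ico 1 n, m i * m (n - i) := by
        rw [Finset.mul_sum, ← Finset.sum_sub_distrib]
        exact Finset.sum_congr rfl fun i _ => by ring
      have hne := (hpos (n + 1)).ne'
      rw [e1, e2]
      field_simp
      linear_combination h3 - 2 * E n * h1 + (E n ^ 2 - V n) * h2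
  have hS := mapCount_sum_Ico_le h0 h
  have hmid : ∀ {f : ℕ → ℝ} {B : ℝ} (n : ℕ), 1 ≤ n → (∀ i ∈ Finset.Ico 1 n, |f i| ≤ B) → 0 ≤ B →
      |(∑ i ∈ Finset.Ico 1 n, m i * m (n - i) * f i) / m (n + 1)| ≤
        14 / ((n : ℝ) + 1) ^ 2 * B := fun n hn hf hB => by
    rw [abs_div, abs_of_pos (hpos (n + 1))]
    have h1 := abs_weighted_sum_le (w := fun i => m i * m (n - i))
      (fun i _ => (mul_pos (hpos i) (hpos (n - i))).le) hf
    refine (div_le_div_of_nonneg_right h1 (hpos (n + 1)).le).trans ?_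
    rw [mul_div_right_comm]
    exact mul_le_mul_of_nonneg_right (hS n hn) hB
  have htri : ∀ {u : ℕ → ℝ} {n : ℕ} {M : ℝ}, (∀ k ≤ n, |u k| ≤ M) → ∀ i ∈ Finset.Ico 1 n,
      |u i + u (n - i) - u n| ≤ 3 * M := fun {u n M} hM i hi => by
    have h1 := abs_le.1 (hM i (Finset.mem_Ico.1 hi).2.le)
    have h2 := abs_le.1 (hM (n - i) (Nat.sub_le _ _))
    have h3 := abs_le.1 (hM n le_rfl)
    exact abs_le.2 ⟨by linarith, by linarith⟩
  have hconv : ∀ (u : ℕ → ℝ) (n : ℕ), 1 ≤ n → ∀ M, (∀ k ≤ n, |u k| ≤ M) →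
      |(∑ i ∈ Finset.Ico 1 n, m i * m (n - i) * (u i + u (n - i) - u n)) / m (n + 1)| ≤
        42 / ((n : ℝ) + 1) ^ 2 * M := fun u n hn M hM => by
    have hM0 : 0 ≤ M := (abs_nonneg _).trans (hM 0 (Nat.zero_le n))
    refine (hmid n hn (htri hM) (by positivity)).trans (le_of_eq ?_)
    ring
  have hratio := tendsto_mapCount_ratio h0 h
  have hEu : ∀ n, 1 ≤ n → ∀ M, (∀ k ≤ n, |E k| ≤ M) →
      |E (n + 1) - E n - 2 * m n / m (n + 1)| ≤ 42 / ((n : ℝ) + 1) ^ 2 * M :=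
    fun n hn M hM => by
      rw [hEinc n hn]
      exact hconv E n hn M hM
  obtain ⟨K, hK0, hK⟩ := exists_abs_le_oneAddHarmonic (by norm_num) hratio hEu
  have hElim := tendsto_mul_sub_of_perturbed_increment hratio hEu hK0 hK
  refine ⟨tendsto_div_log_of_tendsto_mul_sub hElim, ?_⟩
  have hsq : Tendsto (fun n : ℕ => ((n : ℝ) + 1) * (E (n + 1) - E n) ^ 2) atTop (nhds 0) := by
    have := (hElim.pow 2).mul (tendsto_one_div_add_atTop_nhds_zero_nat (𝕜 := ℝ))
    rw [mul_zero] at this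
    refine this.congr fun n => ?_
    field_simp
  have hmidsq : Tendsto (fun n : ℕ => ((n : ℝ) + 1) *
      ((∑ i ∈ Finset.Ico 1 n, m i * m (n - i) * (E i + E (n - i) - E n) ^ 2) / m (n + 1)))
      atTop (nhds 0) := by
    have hlim := tendsto_oneAddHarmonic_sq_div.const_mul (126 * K ^ 2)
    rw [mul_zero] at hlim
    refine squeeze_zero_norm' ?_ hlim
    filter_upwards [eventually_ge_atTop 1] with n hn
    have hM : ∀ k ≤ n, |E k| ≤ K * oneAddHarmonic n := fun k hk =>
      (hK k).trans (mul_le_mul_of_nonneg_left (oneAddHarmonic_mono hk) hK0)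
    have h1 := hmid (f := fun i => (E i + E (n - i) - E n) ^ 2)
      (B := (3 * (K * oneAddHarmonic n)) ^ 2) n hn (fun i hi => by
        rw [abs_pow]
        exact pow_le_pow_left₀ (abs_nonneg _) (htri hM i hi) 2) (sq_nonneg _)
    rw [Real.norm_eq_abs, abs_mul, abs_of_pos (by positivity : (0 : ℝ) < (n : ℝ) + 1)]
    refine (mul_le_mul_of_nonneg_left h1 (by positivity)).trans (le_of_eq ?_)
    field_simp
    ring
  have hd := hratio.add (hmidsq.sub hsq)
  rw [sub_zero, add_zero] at hd
  simp only [← mul_sub, ← mul_add] at hd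
  have hVu := fun n hn M (hM : ∀ k ≤ n, |V k| ≤ M) =>
    (congrArg abs (hVinc n hn)).trans_le (hconv V n hn M hM)
  obtain ⟨L, hL0, hL⟩ := exists_abs_le_oneAddHarmonic (by norm_num) hd hVu
  exact tendsto_div_log_of_tendsto_mul_sub
    (tendsto_mul_sub_of_perturbed_increment hd hVu hL0 hL)
end

section
/- The number of vertices X_n of a uniform random rooted map with n edges satisfies a central limit theorem with logarithmic mean and variance: for every real t, lim_{n→∞} (Σ_{k : k ≤ log n + t·√(log n)} x_{n,k}) / x_n(1) = (1/√(2π)) ∫_{−∞}^{t} e^{−s²/2} ds. -/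
open Polynomial Filter MeasureTheory

/-- The shifted self-convolution `∑_{i+j=m-1} z_i z_j`, empty for `m = 0`. -/
def selfConv {R : Type*} [Semiring R] (z : ℕ → R) (m : ℕ) : R :=
  ∑ i ∈ Finset.range m, z i * z (m - 1 - i)

lemma summable_of_le_telescoping {c T : ℕ → ℝ} {K : ℝ} (hc : ∀ m, 0 ≤ c m) (hT : ∀ m, 0 ≤ T m)
    (hK : 0 ≤ K) (h : ∀ m, c m ≤ K * (T m - T (m + 1))) : Summable c := by
  refine summable_of_sum_range_le (c := K * T 0) hc fun n => ?_
  calc ∑ i ∈ Finset.range n, c i ≤ ∑ i ∈ Finset.range n, K * (T i - T (i + 1)) :=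
        Finset.sum_le_sum fun i _ => h i
    _ = K * (T 0 - T n) := by rw [← Finset.mul_sum, Finset.sum_range_sub']
    _ ≤ K * T 0 := by nlinarith [hT n]

section RealRecurrence

variable {z : ℕ → ℝ}

lemma recurrence_pos (h0 : z 0 = 2)
    (h : ∀ m : ℕ, z (m + 1) = (2 * m + 5) * z m + selfConv z m) (m : ℕ) : 0 < z m := by
  induction m using Nat.strong_induction_on with
  | _ m ih =>
    rcases m with _ | m
    · simp [h0]
    · rw [h]
      have h1 : 0 ≤ selfConv z m := Finset.sum_nonneg fun i hi => by
        have := Finset.mem_range.1 hi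
        exact (mul_pos (ih i (by omega)) (ih _ (by omega))).le
      have := ih m (by omega)
      positivity

lemma recurrence_lower (h0 : z 0 = 2)
    (h : ∀ m : ℕ, z (m + 1) = (2 * m + 5) * z m + selfConv z m) (m : ℕ) :
    (2 * m + 5) * z m ≤ z (m + 1) := by
  rw [h]
  have : 0 ≤ selfConv z m := Finset.sum_nonneg fun i _ =>
    (mul_pos (recurrence_pos h0 h _) (recurrence_pos h0 h _)).le
  linarith

lemma mul_le_of_ratio_le (h0 : z 0 = 2)
    (h : ∀ m : ℕ, z (m + 1) = (2 * m + 5) * z m + selfConv z m) {N : ℕ}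
    (hU : ∀ m < N, z (m + 1) ≤ (2 * m + 7) * z m) (a b : ℕ) (hab : a ≤ b)
    (hN : a < N) : z (a + 1) * z (b + 1) ≤ z 1 * z (a + b + 1) := by
  induction a generalizing b with
  | zero => simp
  | succ a ih =>
    have ha := recurrence_pos h0 h (a + 1)
    have hb := recurrence_pos h0 h (b + 1)
    have h1 := hU (a + 1) hN
    have h2 := recurrence_lower h0 h (b + 1)
    have h3 : (a : ℝ) + 1 ≤ b := by exact_mod_cast hab
    calc z (a + 1 + 1) * z (b + 1) ≤ (2 * (a + 1 : ℕ) + 7) * z (a + 1) * z (b + 1) := by gcongr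
      _ = z (a + 1) * ((2 * (a + 1 : ℕ) + 7) * z (b + 1)) := by ring
      _ ≤ z (a + 1) * ((2 * (b + 1 : ℕ) + 5) * z (b + 1)) := by
          gcongr 1
          apply mul_le_mul_of_nonneg_right _ hb.le
          push_cast; linarith
      _ ≤ z (a + 1) * z (b + 1 + 1) := by gcongr
      _ ≤ z 1 * z (a + (b + 1) + 1) := ih (b + 1) (by omega) (by omega)
      _ = _ := by congr 2; omega

lemma selfConv_le_of_ratio_le (h0 : z 0 = 2)
    (h : ∀ m : ℕ, z (m + 1) = (2 * m + 5) * z m + selfConv z m) (m : ℕ)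
    (hU : ∀ k < m, z (k + 1) ≤ (2 * k + 7) * z k) : selfConv z (m + 1) ≤ 9 * z m := by
  have hz1 : z 1 = 10 := by rw [h 0]; simp [h0, selfConv]; norm_num
  rcases m with _ | p
  · simp [selfConv, h0]; norm_num
  · have hsum : ∑ i ∈ Finset.range p, z (i + 1) * z (p - i) ≤ p * (10 * z p) := by
      have : ∀ i ∈ Finset.range p, z (i + 1) * z (p - i) ≤ 10 * z p := fun i hi => by
        have hi := Finset.mem_range.1 hi
        obtain ⟨b, rfl⟩ : ∃ b, p = i + b + 1 := ⟨p - 1 - i, by omega⟩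
        have e : i + b + 1 - i = b + 1 := by omega
        rw [e, ← hz1]
        rcases le_total i b with hib | hib
        · exact mul_le_of_ratio_le h0 h hU i b hib (by omega)
        · rw [mul_comm (z (i + 1)), add_comm i b]
          exact mul_le_of_ratio_le h0 h hU b i hib (by omega)
      simpa using Finset.sum_le_sum this
    have hS : selfConv z (p + 1 + 1) =
        2 * z 0 * z (p + 1) + ∑ i ∈ Finset.range p, z (i + 1) * z (p - i) := by
      unfold selfConv
      rw [Finset.sum_range_succ, Finset.sum_range_succ']
      have : ∀ i, p + 1 + 1 - 1 - (i + 1) = p - i := fun i => by omega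
      simp only [this]
      simp
      ring
    have h2 := recurrence_lower h0 h p
    have := recurrence_pos h0 h p
    rw [hS, h0]
    nlinarith

lemma ratio_le (h0 : z 0 = 2)
    (h : ∀ m : ℕ, z (m + 1) = (2 * m + 5) * z m + selfConv z m) (m : ℕ) :
    z (m + 1) ≤ (2 * m + 7) * z m := by
  induction m using Nat.strong_induction_on with
  | _ m ih =>
    rcases m with _ | m
    · rw [h 0]; norm_num [selfConv, h0]
    · have h1 := selfConv_le_of_ratio_le h0 h m fun k hk => ih k (by omega)
      have h2 := recurrence_lower h0 h m
      have := recurrence_pos h0 h m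
      rw [h (m + 1)]
      push_cast
      nlinarith

lemma selfConv_succ_le (h0 : z 0 = 2)
    (h : ∀ m : ℕ, z (m + 1) = (2 * m + 5) * z m + selfConv z m) (m : ℕ) :
    selfConv z (m + 1) ≤ 9 * z m :=
  selfConv_le_of_ratio_le h0 h m fun k _ => ratio_le h0 h k

lemma summable_selfConv_div (h0 : z 0 = 2)
    (h : ∀ m : ℕ, z (m + 1) = (2 * m + 5) * z m + selfConv z m) :
    Summable fun m => selfConv z m / ∏ j ∈ Finset.range (m + 1), (2 * (j : ℝ) + 4) := by
  set D : ℕ → ℝ := fun m => ∏ j ∈ Finset.range m, (2 * (j : ℝ) + 4) with hD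
  have hDpos : ∀ m, 0 < D m := fun m => Finset.prod_pos fun j _ => by positivity
  have hDs : ∀ m, D (m + 1) = D m * (2 * m + 4) := fun m => Finset.prod_range_succ _ _
  have hz := recurrence_pos h0 h
  have hc : Summable fun m => z m / D (m + 2) := by
    rw [← summable_nat_add_iff 9]
    refine summable_of_le_telescoping (K := 4)
      (T := fun m => ((m : ℝ) + 9 + 3) * (z (m + 9) / D (m + 9 + 2)))
      (fun m => (div_pos (hz _) (hDpos _)).le)
      (fun m => mul_nonneg (by positivity) (div_pos (hz _) (hDpos _)).le) (by norm_num)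
      fun m => ?_
    have hD3 : D (m + 1 + 9 + 2) = D (m + 9 + 2) * (2 * m + 26) := by
      rw [show m + 1 + 9 + 2 = (m + 9 + 2) + 1 by ring, hDs]; push_cast; ring
    have h1 : z (m + 1 + 9) ≤ (2 * m + 47 / 2) * z (m + 9) := by
      have h2 := selfConv_succ_le h0 h (m + 8)
      have h3 := recurrence_lower h0 h (m + 8)
      have h4 := hz (m + 8)
      rw [show m + 1 + 9 = m + 9 + 1 by ring, h (m + 9)]
      push_cast at *
      nlinarith
    have hpos := hDpos (m + 9 + 2)
    have h5 : ((m + 1 : ℕ) + 9 + 3 : ℝ) * (z (m + 1 + 9) / D (m + 1 + 9 + 2)) ≤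
        (m + 47 / 4) * (z (m + 9) / D (m + 9 + 2)) := by
      rw [hD3]
      have : ((m + 1 : ℕ) + 9 + 3 : ℝ) * (z (m + 1 + 9) / (D (m + 9 + 2) * (2 * m + 26)))
          = z (m + 1 + 9) / 2 / D (m + 9 + 2) := by
        push_cast; field_simp; ring
      rw [this, ← mul_div_assoc]
      gcongr
      linarith
    have h6 := div_pos (hz (m + 9)) hpos
    linarith
  rw [← summable_nat_add_iff 1]
  refine Summable.of_nonneg_of_le (fun m => ?_) (fun m => ?_) (hc.mul_left 9)
  · exact div_nonneg (Finset.sum_nonneg fun i _ => (mul_pos (hz _) (hz _)).le) (hDpos _).le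
  · rw [← mul_div_assoc]
    exact div_le_div_of_nonneg_right (selfConv_succ_le h0 h m) (hDpos _).le

end RealRecurrence

lemma sum_inv_mul_succ_le (m : ℕ) :
    ∑ j ∈ Finset.range m, 1 / (((j : ℝ) + 1) * (j + 2)) ≤ 1 := by
  have : ∀ j : ℕ, 1 / (((j : ℝ) + 1) * (j + 2)) = 1 / ((j : ℝ) + 1) - 1 / ((j + 1 : ℕ) + 1) :=
    fun j => by push_cast; field_simp; ring
  simp only [this]
  rw [Finset.sum_range_sub' (fun j : ℕ => 1 / ((j : ℝ) + 1))]
  have : (0 : ℝ) ≤ 1 / ((m : ℝ) + 1) := by positivity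
  simp at *
  linarith

lemma abs_sum_sub_log_le (m : ℕ) :
    |∑ j ∈ Finset.range m, 1 / ((j : ℝ) + 5 / 2) - Real.log (m + 1)| ≤ 2 := by
  have hH : ((harmonic m : ℚ) : ℝ) = ∑ j ∈ Finset.range m, 1 / ((j : ℝ) + 1) := by
    simp [harmonic]
  have h1 := log_add_one_le_harmonic m
  have h2 := harmonic_le_one_add_log m
  have h3 : Real.log m ≤ Real.log (m + 1) := by
    rcases m with _ | m
    · simp
    · apply Real.log_le_log <;> [positivity; linarith]
  rw [hH] at h1 h2
  have h4 : ∑ j ∈ Finset.range m, 1 / ((j : ℝ) + 5 / 2) ≤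
      ∑ j ∈ Finset.range m, 1 / ((j : ℝ) + 1) :=
    Finset.sum_le_sum fun j _ => by gcongr; norm_num
  have h5 : ∑ j ∈ Finset.range m, 1 / ((j : ℝ) + 1) - ∑ j ∈ Finset.range m, 1 / ((j : ℝ) + 5 / 2)
      ≤ ∑ j ∈ Finset.range m, 3 / 2 * (1 / (((j : ℝ) + 1) * (j + 2))) := by
    rw [← Finset.sum_sub_distrib]
    refine Finset.sum_le_sum fun j _ => ?_
    have : 1 / ((j : ℝ) + 1) - 1 / ((j : ℝ) + 5 / 2) =
        3 / 2 * (1 / (((j : ℝ) + 1) * (j + 5 / 2))) := by field_simp; ring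
    rw [this]
    gcongr
    norm_num
  rw [← Finset.mul_sum] at h5
  have h6 := sum_inv_mul_succ_le m
  push_cast at h1
  rw [abs_le]
  constructor <;> linarith

lemma tendsto_prod_mul_exp_neg_log {w : ℕ → ℂ} (hw : Tendsto w atTop (nhds 0)) :
    Tendsto (fun m : ℕ => (∏ j ∈ Finset.range m, (1 + w m * ((1 / ((j : ℝ) + 5 / 2) : ℝ) : ℂ))) *
      Complex.exp (-(w m * Real.log (m + 1)))) atTop (nhds 1) := by
  set a : ℕ → ℝ := fun j => 1 / ((j : ℝ) + 5 / 2) with ha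
  have ha0 : ∀ j, 0 ≤ a j := fun j => by simp only [ha]; positivity
  have ha1 : ∀ j, a j ≤ 1 := fun j => by
    simp only [ha]; rw [div_le_one (by positivity)]; have : (0 : ℝ) ≤ j := j.cast_nonneg; linarith
  have ha2 : ∀ m, ∑ j ∈ Finset.range m, a j ^ 2 ≤ 1 := fun m => by
    refine (Finset.sum_le_sum fun j _ => ?_).trans (sum_inv_mul_succ_le m)
    simp only [ha, div_pow, one_pow]
    gcongr
    nlinarith [(j.cast_nonneg : (0 : ℝ) ≤ j)]
  have hn : Tendsto (fun m => ‖w m‖) atTop (nhds 0) := by simpa using hw.norm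
  have hsmall : ∀ᶠ m in atTop, ‖w m‖ ≤ 1 / 2 := hn.eventually_le_const (by norm_num)
  have hE : Tendsto (fun m : ℕ => ∑ j ∈ Finset.range m, Complex.log (1 + w m * (a j : ℂ)) -
      w m * Real.log (m + 1)) atTop (nhds 0) := by
    rw [tendsto_zero_iff_norm_tendsto_zero]
    have hb : Tendsto (fun m => ‖w m‖ ^ 2 + ‖w m‖ * 2) atTop (nhds 0) := by
      simpa using (hn.pow 2).add (hn.mul_const 2)
    refine squeeze_zero' (Eventually.of_forall fun _ => norm_nonneg _) ?_ hb
    filter_upwards [hsmall] with m hm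
    have e : ∑ j ∈ Finset.range m, Complex.log (1 + w m * (a j : ℂ)) - w m * Real.log (m + 1) =
        ∑ j ∈ Finset.range m, (Complex.log (1 + w m * (a j : ℂ)) - w m * a j) +
          w m * ((∑ j ∈ Finset.range m, a j - Real.log (m + 1) : ℝ) : ℂ) := by
      rw [Finset.sum_sub_distrib, ← Finset.mul_sum]; push_cast; ring
    rw [e]
    refine (norm_add_le _ _).trans (add_le_add ?_ ?_)
    · refine (norm_sum_le _ _).trans ?_
      calc ∑ j ∈ Finset.range m, ‖Complex.log (1 + w m * (a j : ℂ)) - w m * a j‖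
          ≤ ∑ j ∈ Finset.range m, ‖w m‖ ^ 2 * a j ^ 2 := Finset.sum_le_sum fun j _ => by
            have hz : ‖w m * (a j : ℂ)‖ = ‖w m‖ * a j := by
              rw [norm_mul, Complex.norm_real, Real.norm_of_nonneg (ha0 j)]
            have hz2 : ‖w m * (a j : ℂ)‖ ≤ 1 / 2 := by
              rw [hz]; nlinarith [ha0 j, ha1 j, norm_nonneg (w m)]
            refine (Complex.norm_log_one_add_sub_self_le (by linarith)).trans ?_
            have h1 : (1 - ‖w m * (a j : ℂ)‖)⁻¹ ≤ 2 := by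
              rw [inv_le_comm₀ (by linarith) (by norm_num)]; linarith
            rw [← mul_pow, ← hz]
            nlinarith [sq_nonneg ‖w m * (a j : ℂ)‖]
        _ ≤ ‖w m‖ ^ 2 := by
            rw [← Finset.mul_sum]; exact mul_le_of_le_one_right (by positivity) (ha2 m)
    · rw [norm_mul, Complex.norm_real, Real.norm_eq_abs]
      gcongr
      exact abs_sum_sub_log_le m
  have := (Complex.continuous_exp.tendsto 0).comp hE
  rw [Complex.exp_zero] at this
  refine this.congr' ?_
  filter_upwards [hsmall] with m hm
  simp only [Function.comp]
  rw [sub_eq_add_neg, Complex.exp_add, Complex.exp_sum]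
  congr 1
  refine Finset.prod_congr rfl fun j _ => Complex.exp_log fun h0 => ?_
  have hz : ‖w m * (a j : ℂ)‖ = ‖w m‖ * a j := by
    rw [norm_mul, Complex.norm_real, Real.norm_of_nonneg (ha0 j)]
  have : ‖w m * (a j : ℂ)‖ = 1 := by rw [eq_neg_of_add_eq_zero_right h0]; simp
  nlinarith [ha0 j, ha1 j, norm_nonneg (w m)]

lemma tendsto_exp_sub_one_mul_sq {L : ℕ → ℝ} (hL : Tendsto L atTop atTop) (θ : ℝ) :
    Tendsto (fun n => (Complex.exp ((θ / √(L n) : ℝ) * Complex.I) - 1) * L n -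
      (θ * √(L n) : ℝ) * Complex.I) atTop (nhds (-(θ ^ 2 / 2 : ℝ))) := by
  have hs : Tendsto (fun n => √(L n)) atTop atTop := Real.tendsto_sqrt_atTop.comp hL
  have hu : Tendsto (fun n => |θ| / √(L n)) atTop (nhds 0) := hs.const_div_atTop _
  rw [tendsto_iff_norm_sub_tendsto_zero]
  have hb : Tendsto (fun n => θ ^ 2 * (|θ| / √(L n))) atTop (nhds 0) := by
    simpa using hu.const_mul (θ ^ 2)
  refine squeeze_zero' (Eventually.of_forall fun _ => norm_nonneg _) ?_ hb
  filter_upwards [hu.eventually_le_const zero_lt_one, hs.eventually_gt_atTop 0] with n hn hpos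
  set s := √(L n) with hsdef
  have hLs : L n = s ^ 2 := (Real.sq_sqrt (Real.sqrt_pos.1 hpos).le).symm
  set u : ℂ := ((θ / s : ℝ) : ℂ) * Complex.I with hu'
  have hun : ‖u‖ = |θ| / s := by simp [hu', abs_of_pos hpos]
  have hsc : (s : ℂ) ≠ 0 := by exact_mod_cast hpos.ne'
  have key := Complex.exp_bound (x := u) (by rw [hun]; exact hn) (n := 3) (by norm_num)
  have e : (Complex.exp u - 1) * L n - (θ * s : ℝ) * Complex.I - -((θ ^ 2 / 2 : ℝ) : ℂ) =
      (Complex.exp u - ∑ m ∈ Finset.range 3, u ^ m / m.factorial) * (s ^ 2 : ℝ) := by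
    rw [hLs]
    simp [Finset.sum_range_succ, hu', Nat.factorial]
    field_simp
    linear_combination (θ : ℂ) ^ 2 * Complex.I_sq
  rw [e, norm_mul, Complex.norm_real, Real.norm_of_nonneg (sq_nonneg s)]
  rw [hun] at key
  calc _ ≤ ((|θ| / s) ^ 3 *
          ((Nat.succ 3 : ℕ) * ((Nat.factorial 3 : ℕ) * (3 : ℕ) : ℝ)⁻¹)) * s ^ 2 := by
        gcongr
    _ = θ ^ 2 * (|θ| / s) * (2 / 9) := by
        rw [← sq_abs θ]; norm_num [Nat.factorial]; field_simp
        rw [pow_succ, sq_abs, mul_comm]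
    _ ≤ _ := mul_le_of_le_one_right (by positivity) (by norm_num)

/-- The measure giving mass `p.coeff k / p.eval 1` to the point `f k`. -/
noncomputable def coeffMeasure (p : ℝ[X]) (f : ℕ → ℝ) : Measure ℝ :=
  ∑ k ∈ Finset.range (p.natDegree + 1),
    ENNReal.ofReal (p.coeff k / p.eval 1) • Measure.dirac (f k)

lemma norm_aeval_le_eval_one {p : ℝ[X]} (hp : ∀ k, 0 ≤ p.coeff k)
    {v : ℂ} (hv : ‖v‖ ≤ 1) : ‖aeval v p‖ ≤ p.eval 1 := by
  rw [aeval_eq_sum_range, eval_eq_sum_range]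
  refine (norm_sum_le _ _).trans (Finset.sum_le_sum fun k _ => ?_)
  rw [norm_smul, Real.norm_of_nonneg (hp k), norm_pow, one_pow]
  exact mul_le_mul_of_nonneg_left (pow_le_one₀ (norm_nonneg _) hv) (hp k)

lemma isProbabilityMeasure_coeffMeasure {p : ℝ[X]} (hp : ∀ k, 0 ≤ p.coeff k)
    (h1 : 0 < p.eval 1) (f : ℕ → ℝ) : IsProbabilityMeasure (coeffMeasure p f) := by
  constructor
  simp only [coeffMeasure, Measure.coe_finsetSum, Finset.sum_apply, Measure.smul_apply,
    measure_univ, smul_eq_mul, mul_one]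
  rw [← ENNReal.ofReal_sum_of_nonneg fun k _ => div_nonneg (hp k) h1.le, ← Finset.sum_div]
  have : ∑ k ∈ Finset.range (p.natDegree + 1), p.coeff k = p.eval 1 := by
    simp [eval_eq_sum_range]
  rw [this, div_self h1.ne', ENNReal.ofReal_one]

lemma charFun_coeffMeasure {p : ℝ[X]} (hp : ∀ k, 0 ≤ p.coeff k)
    (h1 : 0 < p.eval 1) (f : ℕ → ℝ) (θ : ℝ) : charFun (coeffMeasure p f) θ =
    ∑ k ∈ Finset.range (p.natDegree + 1),
      ((p.coeff k / p.eval 1 : ℝ) : ℂ) * Complex.exp (θ * f k * Complex.I) := by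
  rw [charFun_apply_real, coeffMeasure, integral_finsetSum_measure]
  · refine Finset.sum_congr rfl fun k _ => ?_
    rw [integral_smul_measure, integral_dirac, ENNReal.toReal_ofReal (div_nonneg (hp k) h1.le)]
    simp
  · intro k _
    exact (integrable_dirac (by simp)).smul_measure ENNReal.ofReal_ne_top

lemma charFun_coeffMeasure_affine {p : ℝ[X]} (hp : ∀ k, 0 ≤ p.coeff k)
    (h1 : 0 < p.eval 1) (θ L s : ℝ) :
    charFun (coeffMeasure p fun k => (k - L) / s) θ =
      aeval (Complex.exp ((θ / s : ℝ) * Complex.I)) p / (p.eval 1 : ℝ) *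
        Complex.exp (-((θ * (L / s) : ℝ) * Complex.I)) := by
  rw [charFun_coeffMeasure hp h1, aeval_eq_sum_range, Finset.sum_div, Finset.sum_mul]
  refine Finset.sum_congr rfl fun k _ => ?_
  rw [← Complex.exp_nat_mul, Complex.real_smul, mul_div_right_comm, mul_assoc (_ / _),
    ← Complex.exp_add]
  push_cast
  congr 2
  ring

lemma coeffMeasure_real_Iic {p : ℝ[X]} (hp : ∀ k, 0 ≤ p.coeff k)
    (h1 : 0 < p.eval 1) (f : ℕ → ℝ) (t : ℝ) : (coeffMeasure p f).real (Set.Iic t) =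
    (∑ k ∈ Finset.range (p.natDegree + 1), if f k ≤ t then p.coeff k else 0) / p.eval 1 := by
  simp only [Measure.real, coeffMeasure, Measure.coe_finsetSum, Finset.sum_apply,
    Measure.smul_apply, smul_eq_mul]
  rw [ENNReal.toReal_sum, Finset.sum_div]
  · refine Finset.sum_congr rfl fun k _ => ?_
    rw [ENNReal.toReal_mul, ENNReal.toReal_ofReal (div_nonneg (hp k) h1.le)]
    by_cases h : f k ≤ t <;> simp [Measure.dirac_apply' _ measurableSet_Iic, h]
  · intro k _
    exact ENNReal.mul_ne_top ENNReal.ofReal_ne_top (measure_ne_top _ _)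

lemma gaussianReal_real_Iic (t : ℝ) : (ProbabilityTheory.gaussianReal 0 1).real (Set.Iic t) =
    (1 / Real.sqrt (2 * Real.pi)) * ∫ s in Set.Iic t, Real.exp (-(s ^ 2) / 2) := by
  rw [Measure.real, ProbabilityTheory.gaussianReal_apply_eq_integral _ one_ne_zero,
    ENNReal.toReal_ofReal
      (integral_nonneg fun _ => ProbabilityTheory.gaussianPDFReal_nonneg _ _ _),
    ← integral_const_mul]
  simp [ProbabilityTheory.gaussianPDFReal]

lemma tendsto_real_Iic_of_tendsto_charFun {μ : ℕ → Measure ℝ} [∀ n, IsProbabilityMeasure (μ n)]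
    (h : ∀ θ : ℝ, Tendsto (fun n => charFun (μ n) θ) atTop (nhds (Complex.exp (-(θ ^ 2 / 2 : ℝ)))))
    (t : ℝ) : Tendsto (fun n => (μ n).real (Set.Iic t)) atTop
      (nhds ((1 / Real.sqrt (2 * Real.pi)) * ∫ s in Set.Iic t, Real.exp (-(s ^ 2) / 2))) := by
  let P : ℕ → ProbabilityMeasure ℝ := fun n => ⟨μ n, inferInstance⟩
  let G : ProbabilityMeasure ℝ := ⟨ProbabilityTheory.gaussianReal 0 1, inferInstance⟩
  have hlim : Tendsto P atTop (nhds G) := by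
    refine ProbabilityMeasure.tendsto_iff_tendsto_charFun.2 fun θ => ?_
    have := h θ
    simp only [P, G, ProbabilityMeasure.coe_mk, ProbabilityTheory.charFun_gaussianReal]
    convert this using 3
    push_cast
    simp
  have hfr : (G : Measure ℝ) (frontier (Set.Iic t)) = 0 := by
    have := ProbabilityTheory.nullSingletonClass_gaussianReal (μ := 0) (v := 1) one_ne_zero
    rw [frontier_Iic]; simp [G]
  have := ProbabilityMeasure.tendsto_measure_of_null_frontier_of_tendsto' hlim hfr
  rw [← gaussianReal_real_Iic]
  exact (ENNReal.tendsto_toReal (measure_ne_top _ _)).comp this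

lemma coeff_nonneg_of_recurrence {x : ℕ → ℝ[X]} (hx0 : x 0 = X)
    (hx : ∀ n : ℕ, x (n + 1) =
      C (2 * ((n : ℝ) + 1) - 1) * x n + ∑ i ∈ Finset.range (n + 1), x i * x (n - i))
    (n k : ℕ) : 0 ≤ (x n).coeff k := by
  induction n using Nat.strong_induction_on generalizing k with
  | _ n ih =>
    rcases n with _ | n
    · rw [hx0, coeff_X]; split_ifs <;> norm_num
    · rw [hx, coeff_add, coeff_C_mul, finsetSum_coeff]
      refine add_nonneg (mul_nonneg ?_ (ih n (by omega) k)) (Finset.sum_nonneg fun i hi => ?_)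
      · have : (0 : ℝ) ≤ n := n.cast_nonneg
        linarith
      · have := Finset.mem_range.1 hi
        rw [coeff_mul]
        exact Finset.sum_nonneg fun q _ => mul_nonneg (ih _ (by omega) _) (ih _ (by omega) _)

lemma recurrence_one {x : ℕ → ℝ[X]} (hx0 : x 0 = X)
    (hx : ∀ n : ℕ, x (n + 1) =
      C (2 * ((n : ℝ) + 1) - 1) * x n + ∑ i ∈ Finset.range (n + 1), x i * x (n - i)) :
    x 1 = X + X ^ 2 := by
  rw [show (1 : ℕ) = 0 + 1 from rfl, hx 0]
  norm_num [hx0]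
  ring

lemma recurrence_succ_succ {x : ℕ → ℝ[X]} (hx0 : x 0 = X)
    (hx : ∀ n : ℕ, x (n + 1) =
      C (2 * ((n : ℝ) + 1) - 1) * x n + ∑ i ∈ Finset.range (n + 1), x i * x (n - i))
    (m : ℕ) : x (m + 2) =
    (C (2 * (m : ℝ) + 3) + (X + X)) * x (m + 1) + selfConv (fun k => x (k + 1)) m := by
  rw [hx (m + 1), Finset.sum_range_succ, Finset.sum_range_succ']
  have : ∑ k ∈ Finset.range m, x (k + 1) * x (m + 1 - (k + 1)) =
      selfConv (fun k => x (k + 1)) m := by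
    refine Finset.sum_congr rfl fun k hk => ?_
    have := Finset.mem_range.1 hk
    rw [show m + 1 - (k + 1) = m - 1 - k + 1 by omega]
  rw [this]
  have e : (2 * (((m + 1 : ℕ) : ℝ) + 1) - 1) = 2 * (m : ℝ) + 3 := by push_cast; ring
  rw [e]
  simp only [Nat.sub_zero, Nat.sub_self, hx0]
  ring

lemma eval_one_recurrence {x : ℕ → ℝ[X]} (hx0 : x 0 = X)
    (hx : ∀ n : ℕ, x (n + 1) =
      C (2 * ((n : ℝ) + 1) - 1) * x n + ∑ i ∈ Finset.range (n + 1), x i * x (n - i))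
    (m : ℕ) : (x (m + 1 + 1)).eval 1 =
    (2 * m + 5) * (x (m + 1)).eval 1 + selfConv (fun k => (x (k + 1)).eval 1) m := by
  rw [recurrence_succ_succ hx0 hx]
  simp [selfConv, eval_finsetSum]
  left
  ring

lemma aeval_recurrence {x : ℕ → ℝ[X]} (hx0 : x 0 = X)
    (hx : ∀ n : ℕ, x (n + 1) =
      C (2 * ((n : ℝ) + 1) - 1) * x n + ∑ i ∈ Finset.range (n + 1), x i * x (n - i))
    (v : ℂ) (m : ℕ) : aeval v (x (m + 1 + 1)) =
    (2 * m + 3 + 2 * v) * aeval v (x (m + 1)) + selfConv (fun k => aeval v (x (k + 1))) m := by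
  rw [recurrence_succ_succ hx0 hx]
  simp [selfConv, two_mul]

lemma eval_one_pos {x : ℕ → ℝ[X]} (hx0 : x 0 = X)
    (hx : ∀ n : ℕ, x (n + 1) =
      C (2 * ((n : ℝ) + 1) - 1) * x n + ∑ i ∈ Finset.range (n + 1), x i * x (n - i))
    (n : ℕ) : 0 < (x n).eval 1 := by
  rcases n with _ | n
  · simp [hx0]
  · exact recurrence_pos (z := fun k => (x (k + 1)).eval 1)
      (by rw [recurrence_one hx0 hx]; norm_num) (eval_one_recurrence hx0 hx) n

/-- The dominant factor of the recurrence for the polynomials evaluated at `v`. -/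
noncomputable def mainProd (v : ℂ) (m : ℕ) : ℂ := ∏ j ∈ Finset.range m, (2 * (j : ℂ) + 3 + 2 * v)

lemma le_norm_mainProd {v : ℂ} (hv : 1 / 2 ≤ v.re) (m : ℕ) :
    ∏ j ∈ Finset.range m, (2 * (j : ℝ) + 4) ≤ ‖mainProd v m‖ := by
  rw [mainProd, norm_prod]
  refine Finset.prod_le_prod (fun j _ => by positivity) fun j _ => ?_
  refine le_trans ?_ (Complex.re_le_norm _)
  simp
  linarith

lemma mainProd_ne_zero {v : ℂ} (hv : 1 / 2 ≤ v.re) (m : ℕ) : mainProd v m ≠ 0 := by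
  rw [← norm_pos_iff]
  exact lt_of_lt_of_le (Finset.prod_pos fun j _ => by positivity) (le_norm_mainProd hv m)

lemma mainProd_div_one (v : ℂ) (m : ℕ) : mainProd v m / mainProd 1 m =
    ∏ j ∈ Finset.range m, (1 + (v - 1) * ((1 / ((j : ℝ) + 5 / 2) : ℝ) : ℂ)) := by
  rw [mainProd, mainProd, ← Finset.prod_div_distrib]
  refine Finset.prod_congr rfl fun j _ => ?_
  have h1 : (2 * (j : ℂ) + 3 + 2 * 1) ≠ 0 := by
    norm_cast
  have h2 : ((j : ℂ) + 5 / 2) = (2 * (j : ℂ) + 3 + 2 * 1) / 2 := by ring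
  push_cast
  rw [h2, div_eq_iff h1, one_div_div, add_mul, mul_assoc, div_mul_cancel₀ _ h1]
  ring

lemma aeval_div_mainProd {x : ℕ → ℝ[X]} (hx0 : x 0 = X)
    (hx : ∀ n : ℕ, x (n + 1) =
      C (2 * ((n : ℝ) + 1) - 1) * x n + ∑ i ∈ Finset.range (n + 1), x i * x (n - i))
    {v : ℂ} (hv : 1 / 2 ≤ v.re) (m : ℕ) :
    aeval v (x (m + 1)) / mainProd v m = v + v ^ 2 + ∑ k ∈ Finset.range m,
      selfConv (fun k => aeval v (x (k + 1))) k / mainProd v (k + 1) := by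
  induction m with
  | zero => simp [mainProd, recurrence_one hx0 hx]
  | succ m ih =>
    rw [Finset.sum_range_succ, ← add_assoc, ← ih, aeval_recurrence hx0 hx]
    have h1 := mainProd_ne_zero hv m
    have h2 := mainProd_ne_zero hv (m + 1)
    have h3 : mainProd v (m + 1) = mainProd v m * (2 * m + 3 + 2 * v) := Finset.prod_range_succ _ _
    rw [h3] at h2 ⊢
    have h4 := right_ne_zero_of_mul h2
    field_simp

lemma tendsto_aeval_div_mainProd {x : ℕ → ℝ[X]} (hx0 : x 0 = X)
    (hx : ∀ n : ℕ, x (n + 1) =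
      C (2 * ((n : ℝ) + 1) - 1) * x n + ∑ i ∈ Finset.range (n + 1), x i * x (n - i))
    {v : ℕ → ℂ} (hv : Tendsto v atTop (nhds 1))
    (hv1 : ∀ n, ‖v n‖ ≤ 1) :
    Tendsto (fun m => aeval (v m) (x (m + 1)) / mainProd (v m) m) atTop
      (nhds (2 + ∑' k, selfConv (fun k => aeval (1 : ℂ) (x (k + 1))) k / mainProd 1 (k + 1))) := by
  have hre : ∀ᶠ m in atTop, 1 / 2 ≤ (v m).re :=
    ((Complex.continuous_re.tendsto 1).comp hv).eventually_const_le (by norm_num)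
  have hsum := summable_selfConv_div (z := fun k => (x (k + 1)).eval 1)
    (by rw [recurrence_one hx0 hx]; norm_num) (eval_one_recurrence hx0 hx)
  have hT : Tendsto (fun m => ∑' k, if k < m then
      selfConv (fun k => aeval (v m) (x (k + 1))) k / mainProd (v m) (k + 1) else 0) atTop
      (nhds (∑' k, selfConv (fun k => aeval (1 : ℂ) (x (k + 1))) k / mainProd 1 (k + 1))) := by
    refine tendsto_tsum_of_dominated_convergence hsum (fun k => ?_) ?_
    · have hcont : ContinuousAt (fun w : ℂ =>
          selfConv (fun k => aeval w (x (k + 1))) k / mainProd w (k + 1)) 1 := by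
        refine ContinuousAt.div ?_ ?_ (mainProd_ne_zero (by norm_num) _)
        · unfold selfConv
          fun_prop
        · unfold mainProd
          fun_prop
      refine (hcont.tendsto.comp hv).congr' ?_
      filter_upwards [eventually_gt_atTop k] with m hm
      simp [hm]
    · filter_upwards [hre] with m hm k
      split_ifs
      · rw [norm_div]
        refine div_le_div₀ ?_ ?_ (Finset.prod_pos fun j _ => by positivity) (le_norm_mainProd hm _)
        · exact Finset.sum_nonneg fun i _ =>
            (mul_pos (eval_one_pos hx0 hx _) (eval_one_pos hx0 hx _)).le
        · refine (norm_sum_le _ _).trans (Finset.sum_le_sum fun i _ => ?_)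
          rw [norm_mul]
          exact mul_le_mul (norm_aeval_le_eval_one (coeff_nonneg_of_recurrence hx0 hx _) (hv1 m))
            (norm_aeval_le_eval_one (coeff_nonneg_of_recurrence hx0 hx _) (hv1 m))
            (norm_nonneg _) (eval_one_pos hx0 hx _).le
      · rw [norm_zero]
        exact div_nonneg (Finset.sum_nonneg fun i _ =>
            (mul_pos (eval_one_pos hx0 hx _) (eval_one_pos hx0 hx _)).le)
          (Finset.prod_nonneg fun j _ => by positivity)
  have h2 : Tendsto (fun m => v m + v m ^ 2) atTop (nhds 2) := by
    have := hv.add (hv.pow 2)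
    norm_num at this
    exact this
  refine (h2.add hT).congr' ?_
  filter_upwards [hre] with m hm
  rw [aeval_div_mainProd hx0 hx hm, tsum_eq_sum (s := Finset.range m)]
  · congr 1
    exact Finset.sum_congr rfl fun k hk => by simp [Finset.mem_range.1 hk]
  · intro k hk
    simp at hk
    simp [hk]

lemma aeval_one_eq_ofReal (p : ℝ[X]) : aeval (1 : ℂ) p = ((p.eval 1 : ℝ) : ℂ) := by
  simp [aeval_eq_sum_range, eval_eq_sum_range]

lemma two_add_tsum_ne_zero {x : ℕ → ℝ[X]} (hx0 : x 0 = X)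
    (hx : ∀ n : ℕ, x (n + 1) =
      C (2 * ((n : ℝ) + 1) - 1) * x n + ∑ i ∈ Finset.range (n + 1), x i * x (n - i))
    :
    2 + ∑' k, selfConv (fun k => aeval (1 : ℂ) (x (k + 1))) k / mainProd 1 (k + 1) ≠ 0 := by
  have : ∀ k, selfConv (fun k => aeval (1 : ℂ) (x (k + 1))) k / mainProd 1 (k + 1) =
      ((selfConv (fun k => (x (k + 1)).eval 1) k /
        ∏ j ∈ Finset.range (k + 1), (2 * (j : ℝ) + 5) : ℝ) : ℂ) := fun k => by
    simp only [aeval_one_eq_ofReal, selfConv, mainProd]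
    push_cast
    congr 1
    exact Finset.prod_congr rfl fun j _ => by ring
  simp only [this]
  rw [← Complex.ofReal_tsum]
  have h : 0 ≤ ∑' k, selfConv (fun k => (x (k + 1)).eval 1) k /
        ∏ j ∈ Finset.range (k + 1), (2 * (j : ℝ) + 5) :=
    tsum_nonneg fun k => div_nonneg (Finset.sum_nonneg fun i _ =>
            (mul_pos (eval_one_pos hx0 hx _) (eval_one_pos hx0 hx _)).le)
          (Finset.prod_nonneg fun j _ => by positivity)
  exact_mod_cast (add_pos_of_pos_of_nonneg two_pos h).ne'

lemma tendsto_aeval_div_eval_one {x : ℕ → ℝ[X]} (hx0 : x 0 = X)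
    (hx : ∀ n : ℕ, x (n + 1) =
      C (2 * ((n : ℝ) + 1) - 1) * x n + ∑ i ∈ Finset.range (n + 1), x i * x (n - i))
    {v : ℕ → ℂ} (hv : Tendsto v atTop (nhds 1))
    (hv1 : ∀ n, ‖v n‖ ≤ 1) :
    Tendsto (fun m : ℕ => aeval (v m) (x (m + 1)) / ((x (m + 1)).eval 1 : ℝ) *
      Complex.exp (-((v m - 1) * Real.log (m + 1)))) atTop (nhds 1) := by
  have hne := two_add_tsum_ne_zero hx0 hx
  have h1 := (tendsto_aeval_div_mainProd hx0 hx hv hv1).div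
    (tendsto_aeval_div_mainProd hx0 hx (v := fun _ => 1) tendsto_const_nhds (by simp)) hne
  have h2 := tendsto_prod_mul_exp_neg_log (w := fun m => v m - 1) (by simpa using hv.sub_const 1)
  have h3 := h1.mul h2
  rw [div_self hne, mul_one] at h3
  refine h3.congr' ?_
  have hre : ∀ᶠ m in atTop, 1 / 2 ≤ (v m).re :=
    ((Complex.continuous_re.tendsto 1).comp hv).eventually_const_le (by norm_num)
  filter_upwards [hre] with m hm
  simp only [Pi.div_apply]
  rw [← mainProd_div_one, aeval_one_eq_ofReal, ← mul_assoc]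
  congr 1
  have := mainProd_ne_zero hm m
  have := mainProd_ne_zero (v := 1) (by norm_num) m
  have : (((x (m + 1)).eval 1 : ℝ) : ℂ) ≠ 0 := by exact_mod_cast (eval_one_pos hx0 hx _).ne'
  field_simp

/-- Central limit theorem with logarithmic mean and variance for the
number of vertices `X_n` of a uniform random rooted map with `n` edges: for every real `t`,
`lim_{n→∞} (Σ_{k ≤ log n + t√(log n)} x_{n,k}) / x_n(1) = (1/√(2π)) ∫_{−∞}^{t} e^{−s²/2} ds`. -/
theorem vertices_clt
    (x : ℕ → Polynomial ℝ) (hx0 : x 0 = X)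
    (hx : ∀ n : ℕ, x (n + 1) =
      C (2 * ((n : ℝ) + 1) - 1) * x n + ∑ i ∈ Finset.range (n + 1), x i * x (n - i)) :
    ∀ t : ℝ,
      Tendsto
        (fun n : ℕ =>
          (∑ k ∈ Finset.range ((x n).natDegree + 1),
              if (k : ℝ) ≤ Real.log n + t * Real.sqrt (Real.log n) then (x n).coeff k else 0) /
            (x n).eval 1)
        atTop
        (nhds ((1 / Real.sqrt (2 * Real.pi)) * ∫ s in Set.Iic t, Real.exp (-(s ^ 2) / 2))) := by
  intro t
  rw [← tendsto_add_atTop_iff_nat 1]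
  set L : ℕ → ℝ := fun m => Real.log (m + 1) with hLdef
  have hL : Tendsto L atTop atTop :=
    Real.tendsto_log_atTop.comp (tendsto_atTop_add_const_right _ _ tendsto_natCast_atTop_atTop)
  have hp : ∀ m, ∀ k, 0 ≤ (x (m + 1)).coeff k := fun m => coeff_nonneg_of_recurrence hx0 hx _
  have h1 : ∀ m, 0 < (x (m + 1)).eval 1 := fun m => eval_one_pos hx0 hx _
  set μ : ℕ → Measure ℝ := fun m => coeffMeasure (x (m + 1)) fun k => (k - L m) / √(L m) with hμ
  have hprob : ∀ m, IsProbabilityMeasure (μ m) := fun m =>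
    isProbabilityMeasure_coeffMeasure (hp m) (h1 m) _
  have hs : Tendsto (fun m => √(L m)) atTop atTop := Real.tendsto_sqrt_atTop.comp hL
  have hchar : ∀ θ : ℝ, Tendsto (fun m => charFun (μ m) θ) atTop
      (nhds (Complex.exp (-(θ ^ 2 / 2 : ℝ)))) := fun θ => by
    have hv : Tendsto (fun m => Complex.exp ((θ / √(L m) : ℝ) * Complex.I)) atTop (nhds 1) := by
      have hc : Continuous fun u : ℝ => Complex.exp (u * Complex.I) := by fun_prop
      simpa [Function.comp_def] using (hc.tendsto 0).comp (hs.const_div_atTop θ)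
    have hq := (tendsto_aeval_div_eval_one hx0 hx hv
      fun n => (Complex.norm_exp_ofReal_mul_I _).le).mul
      ((Complex.continuous_exp.tendsto _).comp (tendsto_exp_sub_one_mul_sq hL θ))
    rw [one_mul] at hq
    refine hq.congr fun m => ?_
    rw [hμ, charFun_coeffMeasure_affine (hp m) (h1 m), Real.div_sqrt, Function.comp_apply,
      mul_assoc, ← Complex.exp_add]
    congr 2
    ring
  refine (tendsto_real_Iic_of_tendsto_charFun hchar t).congr' ?_
  filter_upwards [hs.eventually_gt_atTop 0] with m hm
  rw [hμ, coeffMeasure_real_Iic (hp m) (h1 m)]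
  congr 1
  refine Finset.sum_congr rfl fun k _ => ?_
  have : ((k : ℝ) - L m) / √(L m) ≤ t ↔
      (k : ℝ) ≤ Real.log ((m + 1 : ℕ) : ℝ) + t * √(Real.log ((m + 1 : ℕ) : ℝ)) := by
    rw [div_le_iff₀ hm, sub_le_iff_le_add']
    simp [hLdef]
  simp only [this]
end

section
/- The number of root edges E_n of a uniform random rooted map with n edges, rescaled by n, converges in distribution to the Beta(1, 1/2) law with density (1/2)(1−t)^{−1/2} on [0,1): for every t ∈ [0,1), lim_{n→∞} (Σ_{k=0}^{⌊tn⌋} e_{n,k}) / m(n) = 1 − √(1−t). -/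
open Polynomial Filter

/-- The recurrence for the number of rooted maps, over the reals. -/
structure IsMapCount (x : ℕ → ℝ) : Prop where
  zero : x 0 = 1
  succ : ∀ n, x (n + 1) =
    ∑ k ∈ Finset.range (n + 1), x k * x (n - k) + (2 * n + 1) * x n

/-- The convolution `∑ x i * x j` over `i + j = p + 1` with `i, j ≥ 1`. -/
noncomputable def innerConv (x : ℕ → ℝ) (p : ℕ) : ℝ :=
  ∑ i ∈ Finset.range p, x (i + 1) * x (p - i)

/-- The product of the first `n` positive even numbers. -/
noncomputable def evenFactorial (n : ℕ) : ℝ := 2 ^ n * (n.factorial : ℝ)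

lemma evenFactorial_pos (n : ℕ) : 0 < evenFactorial n := by
  unfold evenFactorial; positivity

lemma evenFactorial_succ (n : ℕ) :
    evenFactorial (n + 1) = (2 * n + 2) * evenFactorial n := by
  unfold evenFactorial; rw [Nat.factorial_succ]; push_cast; ring

namespace IsMapCount

variable {x : ℕ → ℝ}

lemma pos (hx : IsMapCount x) (n : ℕ) : 0 < x n := by
  induction n using Nat.strong_induction_on with
  | _ n ih =>
    cases n with
    | zero => rw [hx.zero]; exact one_pos
    | succ n =>
      rw [hx.succ]
      have h1 : 0 ≤ ∑ k ∈ Finset.range (n + 1), x k * x (n - k) :=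
        Finset.sum_nonneg fun k hk => by
          have := Finset.mem_range.1 hk
          exact (mul_pos (ih k (by omega)) (ih (n - k) (by omega))).le
      have := ih n (by omega)
      positivity

lemma innerConv_nonneg (hx : IsMapCount x) (p : ℕ) : 0 ≤ innerConv x p :=
  Finset.sum_nonneg fun _ _ => (mul_pos (hx.pos _) (hx.pos _)).le

lemma one (hx : IsMapCount x) : x 1 = 2 := by
  have h := hx.succ 0
  simp [hx.zero] at h
  linarith

lemma add_two (hx : IsMapCount x) (p : ℕ) :
    x (p + 2) = (2 * p + 5) * x (p + 1) + innerConv x p := by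
  have h := hx.succ (p + 1)
  rw [Finset.sum_range_succ, Finset.sum_range_succ'] at h
  simp only [Nat.sub_self, Nat.sub_zero, hx.zero, Nat.add_sub_add_right] at h
  rw [h, innerConv]
  push_cast
  ring

lemma two (hx : IsMapCount x) : x 2 = 10 := by
  have h := hx.add_two 0
  simp [innerConv, hx.one] at h
  linarith

lemma mul_le_add_two (hx : IsMapCount x) (p : ℕ) :
    (2 * p + 5) * x (p + 1) ≤ x (p + 2) := by
  rw [hx.add_two]
  linarith [hx.innerConv_nonneg p]

lemma mul_le_of_ratio_le (hx : IsMapCount x) (p : ℕ)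
    (h : ∀ k < 2 + p, x (k + 1) ≤ (2 * k + 5) * x k) (j : ℕ) (hj : 2 + p ≤ j) :
    x (2 + p) * x j ≤ x 2 * x (p + j) := by
  induction p generalizing j with
  | zero => simp
  | succ p ih =>
    have h1 := h (2 + p) (by omega)
    obtain ⟨q, rfl⟩ : ∃ q, j = q + 1 := ⟨j - 1, by omega⟩
    have h2 := ih (fun k hk => h k (by omega)) (q + 2) (by omega)
    have h3 := hx.mul_le_add_two q
    have hq : (2 + p : ℝ) ≤ q := by exact_mod_cast (by omega : 2 + p ≤ q)
    push_cast at h1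
    have e1 : p + 1 + (q + 1) = p + (q + 2) := by ring
    rw [e1, ← add_assoc 2 p 1]
    refine le_trans ?_ h2
    have hp := hx.pos (2 + p)
    have hq' := hx.pos (q + 1)
    calc x (2 + p + 1) * x (q + 1)
        ≤ ((2 * (2 + p) + 5) * x (2 + p)) * x (q + 1) := by gcongr
      _ ≤ x (2 + p) * ((2 * q + 5) * x (q + 1)) := by
        nlinarith [mul_pos hp hq']
      _ ≤ x (2 + p) * x (q + 2) := by gcongr

lemma innerConv_le_of_ratio_le (hx : IsMapCount x) (p : ℕ)
    (h : ∀ k < p, x (k + 1) ≤ (2 * k + 5) * x k) : innerConv x p ≤ 9 * x p := by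
  match p with
  | 0 => simp [innerConv, hx.zero]
  | 1 => simp [innerConv, hx.one]; norm_num
  | q + 2 =>
    have hsum : ∑ i ∈ Finset.range q, x (i + 2) * x (q + 1 - i) ≤ q * (10 * x (q + 1)) := by
      have := Finset.sum_le_card_nsmul (Finset.range q)
        (fun i => x (i + 2) * x (q + 1 - i)) (10 * x (q + 1)) ?_
      · simpa using this
      · intro i hi
        have hi := Finset.mem_range.1 hi
        rw [← hx.two]
        rcases le_total (i + 2) (q + 1 - i) with hle | hle
        · have := hx.mul_le_of_ratio_le i (fun k hk => h k (by omega)) (q + 1 - i) (by omega)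
          rwa [add_comm 2 i, (by omega : i + (q + 1 - i) = q + 1)] at this
        · have := hx.mul_le_of_ratio_le (q - 1 - i) (fun k hk => h k (by omega)) (i + 2) (by omega)
          rw [(by omega : 2 + (q - 1 - i) = q + 1 - i),
            (by omega : q - 1 - i + (i + 2) = q + 1)] at this
          linarith
    rw [innerConv, Finset.sum_range_succ, Finset.sum_range_succ']
    have e1 : ∀ i, q + 2 - (i + 1) = q + 1 - i := fun i => by omega
    have e2 : q + 1 - q = 1 := by omega
    simp only [e1, e2, zero_add, Nat.sub_zero, hx.one, add_assoc, Nat.reduceAdd]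
    have := hx.mul_le_add_two q
    have := hx.pos (q + 1)
    linarith

lemma ratio_le (hx : IsMapCount x) (n : ℕ) : x (n + 1) ≤ (2 * n + 5) * x n := by
  induction n using Nat.strong_induction_on with
  | _ n ih =>
    match n with
    | 0 => simp [hx.zero, hx.one]; norm_num
    | 1 => simp [hx.two, hx.one]; norm_num
    | q + 2 =>
      have h1 := hx.innerConv_le_of_ratio_le (q + 1) fun k hk => ih k (by omega)
      have h2 := hx.mul_le_add_two q
      have h3 := hx.add_two (q + 1)
      have h4 := hx.pos (q + 1)
      rw [(by ring : q + 1 + 2 = q + 2 + 1), (by ring : q + 1 + 1 = q + 2)] at h3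
      rw [h3]
      push_cast
      nlinarith [mul_nonneg (Nat.cast_nonneg (α := ℝ) q) h4.le]

lemma innerConv_le (hx : IsMapCount x) (p : ℕ) : innerConv x p ≤ 9 * x p :=
  hx.innerConv_le_of_ratio_le p fun k _ => hx.ratio_le k

end IsMapCount

/-- The sequence `x` divided by `2 ^ n * n!`. -/
noncomputable def normalized (x : ℕ → ℝ) (n : ℕ) : ℝ := x n / evenFactorial n

namespace IsMapCount

variable {x : ℕ → ℝ}

lemma normalized_pos (hx : IsMapCount x) (n : ℕ) : 0 < normalized x n :=
  div_pos (hx.pos n) (evenFactorial_pos n)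

lemma normalized_succ_ge (hx : IsMapCount x) (n : ℕ) :
    (1 + 1 / (2 * (n + 2))) * normalized x (n + 1) ≤ normalized x (n + 2) := by
  have h := hx.mul_le_add_two n
  have hb := evenFactorial_pos (n + 1)
  unfold normalized
  rw [evenFactorial_succ (n + 1)]
  push_cast
  rw [le_div_iff₀ (by positivity)]
  calc _ = (2 * n + 5) * x (n + 1) := by field_simp; ring
    _ ≤ _ := h

lemma normalized_succ_le (hx : IsMapCount x) (n : ℕ) :
    normalized x (n + 3) ≤
      (1 + (2 * n + 14) / ((2 * n + 5) * (2 * n + 6))) * normalized x (n + 2) := by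
  have h := hx.mul_le_add_two n
  have h1 := hx.add_two (n + 1)
  have h2 := hx.innerConv_le (n + 1)
  have hb := evenFactorial_pos (n + 2)
  rw [(by ring : n + 1 + 2 = n + 3), (by ring : n + 1 + 1 = n + 2)] at h1
  have h3 : x (n + 1) ≤ x (n + 2) / (2 * n + 5) := by
    rw [le_div_iff₀ (by positivity)]; linarith
  unfold normalized
  rw [evenFactorial_succ (n + 2)]
  push_cast at h1 ⊢
  rw [div_le_iff₀ (by positivity)]
  calc x (n + 3) ≤ (2 * (n + 1) + 5) * x (n + 2) + 9 * (x (n + 2) / (2 * n + 5)) := by linarith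
    _ = _ := by field_simp; ring

lemma normalized_monotone (hx : IsMapCount x) : Monotone (normalized x) := by
  refine monotone_nat_of_le_succ fun n => ?_
  cases n with
  | zero => simp [normalized, evenFactorial, hx.zero, hx.one]
  | succ n =>
    refine le_trans ?_ (hx.normalized_succ_ge n)
    refine le_mul_of_one_le_left (hx.normalized_pos _).le ?_
    simp only [le_add_iff_nonneg_right]; positivity

lemma normalized_sq_div_monotone (hx : IsMapCount x) :
    Monotone fun n : ℕ => normalized x (n + 1) ^ 2 / ((n : ℝ) + 2) := by
  refine monotone_nat_of_le_succ fun n => ?_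
  have h := hx.normalized_succ_ge n
  have hp := hx.normalized_pos (n + 1)
  push_cast
  rw [le_div_iff₀ (by positivity)]
  refine le_trans ?_ (pow_le_pow_left₀ (by positivity) h 2)
  rw [mul_pow, div_mul_eq_mul_div, div_le_iff₀ (by positivity), mul_assoc, mul_comm,
    mul_comm (normalized x (n + 1) ^ 2), ← mul_assoc]
  refine mul_le_mul_of_nonneg_right ?_ (by positivity)
  have : (1 + 1 / (2 * ((n : ℝ) + 2))) ^ 2 * (n + 2) = n + 3 + 1 / (4 * (n + 2)) := by
    field_simp; ring
  rw [this]
  have : 0 ≤ 1 / (4 * ((n : ℝ) + 2)) := by positivity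
  linarith

lemma normalized_sq_div_antitone (hx : IsMapCount x) :
    Antitone fun n : ℕ => normalized x (n + 11) ^ 2 / ((n : ℝ) + 1) := by
  refine antitone_nat_of_succ_le fun n => ?_
  have h := hx.normalized_succ_le (n + 9)
  have hp := hx.normalized_pos (n + 11)
  have hp' := hx.normalized_pos (n + 12)
  rw [(by ring : n + 9 + 3 = n + 12), (by ring : n + 9 + 2 = n + 11)] at h
  rw [(by ring : n + 1 + 11 = n + 12)]
  push_cast at h ⊢
  rw [div_le_div_iff₀ (by positivity) (by positivity)]
  have key : (1 + (2 * ((n : ℝ) + 9) + 14) / ((2 * (n + 9) + 5) * (2 * (n + 9) + 6))) ^ 2 * (n + 1)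
      ≤ n + 1 + 1 := by
    rw [one_add_div (by positivity), div_pow, div_mul_eq_mul_div, div_le_iff₀ (by positivity)]
    rw [← sub_nonneg]
    ring_nf
    positivity
  calc normalized x (n + 12) ^ 2 * (n + 1)
      ≤ ((1 + (2 * ((n : ℝ) + 9) + 14) / ((2 * (n + 9) + 5) * (2 * (n + 9) + 6))) *
          normalized x (n + 11)) ^ 2 * (n + 1) := by gcongr
    _ = (1 + (2 * ((n : ℝ) + 9) + 14) / ((2 * (n + 9) + 5) * (2 * (n + 9) + 6))) ^ 2 * (n + 1) *
          normalized x (n + 11) ^ 2 := by rw [mul_pow]; ring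
    _ ≤ (n + 1 + 1) * normalized x (n + 11) ^ 2 := by gcongr
    _ = _ := by ring

lemma exists_tendsto_normalized_sq_div (hx : IsMapCount x) :
    ∃ L : ℝ, 0 < L ∧
      Tendsto (fun n : ℕ => normalized x n ^ 2 / ((n : ℝ) + 1)) atTop (nhds L) := by
  set u : ℕ → ℝ := fun n => normalized x (n + 1) ^ 2 / ((n : ℝ) + 2) with hu
  have hmono : Monotone u := hx.normalized_sq_div_monotone
  have hbdd : BddAbove (Set.range u) := by
    refine ⟨normalized x 11 ^ 2, ?_⟩
    rintro _ ⟨n, rfl⟩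
    have h := hx.normalized_sq_div_antitone (Nat.zero_le n)
    simp only [Nat.cast_zero, zero_add, div_one] at h
    refine (hmono (by omega : n ≤ n + 10)).trans (le_trans ?_ h)
    simp only [hu]
    rw [(by ring : n + 10 + 1 = n + 11)]
    push_cast
    exact div_le_div_of_nonneg_left (by positivity) (by positivity) (by linarith)
  have h0 : 0 < u 0 := by
    have := hx.normalized_pos 1
    simp only [hu]; positivity
  refine ⟨⨆ n, u n, h0.trans_le (le_ciSup hbdd 0), (tendsto_add_atTop_iff_nat 1).1 ?_⟩
  refine (tendsto_atTop_ciSup hmono hbdd).congr fun n => ?_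
  simp only [hu]
  push_cast
  ring

lemma tendsto_normalized_ratio (hx : IsMapCount x) {l : ℕ → ℕ} (hl : Tendsto l atTop atTop)
    {s : ℝ} (hs : Tendsto (fun n : ℕ => ((l n : ℝ) + 1) / ((n : ℝ) + 1)) atTop (nhds s)) :
    Tendsto (fun n => normalized x (l n) / normalized x n) atTop (nhds (Real.sqrt s)) := by
  obtain ⟨L, hL, h⟩ := hx.exists_tendsto_normalized_sq_div
  have h1 := (((h.comp hl).div h hL.ne').mul hs).sqrt
  rw [div_self hL.ne', one_mul] at h1
  refine h1.congr fun n => ?_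
  have hp := hx.normalized_pos n
  have hp' := hx.normalized_pos (l n)
  rw [← Real.sqrt_sq (div_pos hp' hp).le]
  congr 1
  simp only [Function.comp, Pi.div_apply]
  field_simp

end IsMapCount

/-- Tail sums `A n K` attached to `x`: the recurrence satisfied by the number of rooted maps
with `n` edges and at least `K` root edges. -/
structure IsTailCount (x : ℕ → ℝ) (A : ℕ → ℕ → ℝ) : Prop where
  zero_right : ∀ n, A n 0 = x n
  zero_succ : ∀ K, A 0 (K + 1) = 0
  succ_succ : ∀ n K, A (n + 1) (K + 1) =
    (2 * n + 1) * A n K + ∑ i ∈ Finset.range (n + 1), x i * A (n - i) K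

namespace IsTailCount

variable {x : ℕ → ℝ} {A : ℕ → ℕ → ℝ}

lemma nonneg_and_le (hA : IsTailCount x A) (hx : IsMapCount x) (n K : ℕ) :
    0 ≤ A n K ∧ A n K ≤ x n := by
  induction K generalizing n with
  | zero => rw [hA.zero_right]; exact ⟨(hx.pos n).le, le_rfl⟩
  | succ K ih =>
    cases n with
    | zero => rw [hA.zero_succ]; exact ⟨le_rfl, (hx.pos 0).le⟩
    | succ n =>
      rw [hA.succ_succ, hx.succ]
      constructor
      · have h1 := (ih n).1
        have : 0 ≤ ∑ i ∈ Finset.range (n + 1), x i * A (n - i) K :=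
          Finset.sum_nonneg fun i _ => mul_nonneg (hx.pos i).le (ih _).1
        positivity
      · have h1 : (2 * (n : ℝ) + 1) * A n K ≤ (2 * n + 1) * x n :=
          mul_le_mul_of_nonneg_left (ih n).2 (by positivity)
        have : ∑ i ∈ Finset.range (n + 1), x i * A (n - i) K ≤
            ∑ i ∈ Finset.range (n + 1), x i * x (n - i) :=
          Finset.sum_le_sum fun i _ => mul_le_mul_of_nonneg_left (ih _).2 (hx.pos i).le
        linarith

lemma mul_le_succ_succ (hA : IsTailCount x A) (hx : IsMapCount x) (n K : ℕ) :
    (2 * n + 2) * A n K ≤ A (n + 1) (K + 1) := by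
  rw [hA.succ_succ, Finset.sum_range_succ', hx.zero, Nat.sub_zero]
  have : 0 ≤ ∑ i ∈ Finset.range n, x (i + 1) * A (n - (i + 1)) K :=
    Finset.sum_nonneg fun i _ => mul_nonneg (hx.pos _).le (hA.nonneg_and_le hx _ _).1
  linarith

lemma succ_succ_le (hA : IsTailCount x A) (hx : IsMapCount x) (p K : ℕ) :
    A (p + 2) (K + 2) ≤ (2 * p + 4) * A (p + 1) (K + 1) + 9 * x p := by
  rw [hA.succ_succ, Finset.sum_range_succ, Finset.sum_range_succ', hx.zero, Nat.sub_zero,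
    Nat.sub_self, hA.zero_succ]
  simp only [Nat.add_sub_add_right]
  have : ∑ i ∈ Finset.range p, x (i + 1) * A (p - i) (K + 1) ≤ innerConv x p := by
    refine Finset.sum_le_sum fun i _ => ?_
    exact mul_le_mul_of_nonneg_left (hA.nonneg_and_le hx _ _).2 (hx.pos _).le
  have := hx.innerConv_le p
  push_cast
  linarith

lemma normalized_le (hA : IsTailCount x A) (hx : IsMapCount x) (n k : ℕ) :
    normalized x n ≤ A (n + k) k / evenFactorial (n + k) := by
  induction k with
  | zero => rw [hA.zero_right]; rfl
  | succ k ih =>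
    refine ih.trans ?_
    have h := hA.mul_le_succ_succ hx (n + k) k
    have hb := evenFactorial_pos (n + k)
    rw [← add_assoc, evenFactorial_succ, div_le_div_iff₀ hb (by positivity)]
    nlinarith

lemma le_normalized (hA : IsTailCount x A) (hx : IsMapCount x) (n k : ℕ) :
    A (n + 1 + k) (k + 1) / evenFactorial (n + 1 + k) ≤
      normalized x (n + 1) +
        9 / 4 * normalized x (n + 1 + k) * (1 / (n + 1) - 1 / (n + 1 + k)) := by
  induction k with
  | zero =>
    simp only [add_zero, Nat.cast_zero, sub_self, mul_zero]
    exact div_le_div_of_nonneg_right (hA.nonneg_and_le hx _ _).2 (evenFactorial_pos _).le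
  | succ k ih =>
    have h := hA.succ_succ_le hx (n + k) k
    have hb := evenFactorial_pos (n + k)
    have e1 : n + 1 + k = n + k + 1 := by ring
    have e2 : n + 1 + (k + 1) = n + k + 2 := by ring
    rw [e1] at ih
    rw [e2]
    have m1 : normalized x (n + k) ≤ normalized x (n + k + 2) :=
      hx.normalized_monotone (by omega)
    have m2 : normalized x (n + k + 1) ≤ normalized x (n + k + 2) :=
      hx.normalized_monotone (by omega)
    have b2 : evenFactorial (n + k + 2) = (2 * (n + k) + 4) * evenFactorial (n + k + 1) := by
      rw [evenFactorial_succ (n + k + 1)]; push_cast; ring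
    have b1 : evenFactorial (n + k + 1) = (2 * (n + k) + 2) * evenFactorial (n + k) := by
      rw [evenFactorial_succ (n + k)]; push_cast; ring
    have step : A (n + k + 2) (k + 2) / evenFactorial (n + k + 2) ≤
        A (n + k + 1) (k + 1) / evenFactorial (n + k + 1) +
          9 / 4 * normalized x (n + k) * (1 / (n + 1 + k) - 1 / (n + 1 + (k + 1))) := by
      push_cast at h
      calc _ ≤ _ / evenFactorial (n + k + 2) :=
            div_le_div_of_nonneg_right h (evenFactorial_pos _).le
        _ = _ := by
          unfold normalized
          rw [b2, b1]
          have : (n : ℝ) + 1 + k ≠ 0 := by positivity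
          have : (n : ℝ) + 1 + (k + 1) ≠ 0 := by positivity
          have : (n : ℝ) + k + 1 ≠ 0 := by positivity
          have : (n : ℝ) + k + 2 ≠ 0 := by positivity
          field_simp
          ring
    push_cast
    have d1 : 0 ≤ 1 / ((n : ℝ) + 1 + k) - 1 / (n + 1 + (k + 1)) :=
      sub_nonneg.2 (one_div_le_one_div_of_le (by positivity) (by linarith))
    have d2 : 0 ≤ 1 / ((n : ℝ) + 1) - 1 / (n + 1 + k) :=
      sub_nonneg.2 (one_div_le_one_div_of_le (by positivity) (by
        have : (0 : ℝ) ≤ k := by positivity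
        linarith))
    nlinarith [mul_le_mul_of_nonneg_right m1 d1, mul_le_mul_of_nonneg_right m2 d2]

lemma tendsto_div (hA : IsTailCount x A) (hx : IsMapCount x) {t : ℝ} (ht0 : 0 ≤ t)
    (ht1 : t < 1) :
    Tendsto (fun n : ℕ => A n (⌊t * n⌋₊ + 1) / x n) atTop (nhds (Real.sqrt (1 - t))) := by
  set l : ℕ → ℕ := fun n => n - (⌊t * n⌋₊ + 1) with hl
  have hfloor : ∀ n : ℕ, 0 < n → l n + 1 + ⌊t * n⌋₊ = n := fun n hn => by
    have : ⌊t * n⌋₊ < n := by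
      rw [Nat.floor_lt (by positivity)]
      have : (0 : ℝ) < n := by exact_mod_cast hn
      nlinarith
    simp only [hl]
    omega
  have hcast : ∀ᶠ n : ℕ in atTop, (l n : ℝ) + 1 = n - ⌊t * n⌋₊ := by
    filter_upwards [eventually_gt_atTop 0] with n hn
    have : ((l n + 1 + ⌊t * n⌋₊ : ℕ) : ℝ) = n := by rw [hfloor n hn]
    push_cast at this
    linarith
  have hinv : Tendsto (fun n : ℕ => 1 / ((n : ℝ) + 1)) atTop (nhds 0) :=
    tendsto_one_div_add_atTop_nhds_zero_nat
  have hratio : Tendsto (fun n : ℕ => ((l n : ℝ) + 1) / ((n : ℝ) + 1)) atTop (nhds (1 - t)) := by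
    have h1 : Tendsto (fun n : ℕ => (⌊t * n⌋₊ : ℝ) / n) atTop (nhds t) :=
      (tendsto_nat_floor_mul_div_atTop ht0).comp tendsto_natCast_atTop_atTop
    have h2 : Tendsto (fun n : ℕ => (1 - (⌊t * n⌋₊ : ℝ) / n) * (1 - 1 / ((n : ℝ) + 1))) atTop
        (nhds ((1 - t) * (1 - 0))) := (h1.const_sub 1).mul (hinv.const_sub 1)
    rw [sub_zero, mul_one] at h2
    refine h2.congr' ?_
    filter_upwards [hcast, eventually_gt_atTop 0] with n hn hn0
    have : (n : ℝ) ≠ 0 := by exact_mod_cast hn0.ne'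
    rw [hn]
    field_simp
    ring
  have hltop' : Tendsto (fun n => (l n : ℝ) + 1) atTop atTop := by
    have h : Tendsto (fun n : ℕ => (n : ℝ) + 1) atTop atTop :=
      tendsto_atTop_add_const_right _ _ tendsto_natCast_atTop_atTop
    refine (hratio.pos_mul_atTop (sub_pos.2 ht1) h).congr fun n => ?_
    field_simp
  have hltop : Tendsto l atTop atTop := by
    refine tendsto_natCast_atTop_iff (R := ℝ) |>.1 ?_
    simpa using tendsto_atTop_add_const_right atTop (-1 : ℝ) hltop'
  have hlow := hx.tendsto_normalized_ratio hltop hratio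
  have hratio' : Tendsto (fun n : ℕ => (((l n + 1 : ℕ) : ℝ) + 1) / ((n : ℝ) + 1)) atTop
      (nhds (1 - t)) := by
    have := hratio.add hinv
    rw [add_zero] at this
    refine this.congr fun n => ?_
    push_cast
    ring
  have hup := (hx.tendsto_normalized_ratio ((tendsto_add_atTop_nat 1).comp hltop) hratio').add
    (hltop'.inv_tendsto_atTop.const_mul (9 / 4))
  rw [mul_zero, add_zero] at hup
  refine tendsto_of_tendsto_of_tendsto_of_le_of_le' hlow hup ?_ ?_
  · filter_upwards [eventually_gt_atTop 0] with n hn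
    have h := hA.normalized_le hx (l n) (⌊t * n⌋₊ + 1)
    have e1 : l n + (⌊t * n⌋₊ + 1) = n := by
      have := hfloor n hn
      omega
    rw [e1] at h
    have hp := hx.pos n
    have hb := evenFactorial_pos n
    calc _ ≤ A n (⌊t * n⌋₊ + 1) / evenFactorial n / normalized x n :=
          div_le_div_of_nonneg_right h (hx.normalized_pos n).le
      _ = _ := by unfold normalized; field_simp
  · filter_upwards [eventually_gt_atTop 0] with n hn
    have h := hA.le_normalized hx (l n) ⌊t * n⌋₊
    rw [hfloor n hn] at h
    have hp := hx.pos n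
    have hb := evenFactorial_pos n
    have ha := hx.normalized_pos n
    have h' : A n (⌊t * n⌋₊ + 1) / evenFactorial n ≤
        normalized x (l n + 1) + 9 / 4 * normalized x n * (1 / (l n + 1)) := by
      refine h.trans ?_
      gcongr
      exact sub_le_self _ (by positivity)
    calc A n (⌊t * n⌋₊ + 1) / x n
        = A n (⌊t * n⌋₊ + 1) / evenFactorial n / normalized x n := by
          unfold normalized; field_simp
      _ ≤ _ / normalized x n := div_le_div_of_nonneg_right h' ha.le
      _ = _ := by
          simp only [Function.comp, Pi.inv_apply]
          field_simp

end IsTailCount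

/-- The number of root edges `E_n` of a uniform random rooted map with `n`
edges, rescaled by `n`, converges in distribution to the `Beta(1, 1/2)` law with density
`(1/2)(1−t)^{−1/2}` on `[0,1)`: for every `t ∈ [0,1)`,
`lim_{n→∞} (Σ_{k=0}^{⌊tn⌋} e_{n,k}) / m(n) = 1 − √(1−t)`. -/
theorem root_edges_beta_law
    (m : ℕ → ℕ) (hm0 : m 0 = 1)
    (hm : ∀ n : ℕ, m (n + 1) =
      (∑ k ∈ Finset.range (n + 1), m k * m (n - k)) + (2 * (n + 1) - 1) * m n)
    (e : ℕ → Polynomial ℝ) (he0 : e 0 = 1)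
    (he : ∀ n : ℕ, e (n + 1) =
      C (2 * ((n : ℝ) + 1) - 1) * X * e n +
        X * ∑ i ∈ Finset.range (n + 1), C ((m i : ℝ)) * e (n - i)) :
    ∀ t : ℝ, 0 ≤ t → t < 1 →
      Tendsto
        (fun n : ℕ =>
          (∑ k ∈ Finset.range (⌊t * n⌋₊ + 1), (e n).coeff k) / (m n : ℝ))
        atTop (nhds (1 - Real.sqrt (1 - t))) := by
  intro t ht0 ht1
  have hx : IsMapCount fun n => (m n : ℝ) := by
    refine ⟨by simp [hm0], fun n => ?_⟩
    have h := hm n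
    rw [(by omega : 2 * (n + 1) - 1 = 2 * n + 1)] at h
    simp only [h]
    push_cast
    rfl
  have hA : IsTailCount (fun n => (m n : ℝ))
      fun n K => m n - ∑ k ∈ Finset.range K, (e n).coeff k := by
    refine ⟨fun n => by simp, fun K => ?_, fun n K => ?_⟩
    · rw [Finset.sum_range_succ']
      simp [he0, hm0, coeff_one]
    · have hc0 : (e (n + 1)).coeff 0 = 0 := by
        rw [he, mul_assoc, mul_comm X, ← mul_assoc, mul_comm, ← mul_assoc]
        simp [mul_coeff_zero]
      have hc : ∀ k, (e (n + 1)).coeff (k + 1) = (2 * n + 1) * (e n).coeff k +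
          ∑ i ∈ Finset.range (n + 1), (m i : ℝ) * (e (n - i)).coeff k := fun k => by
        rw [he, mul_assoc, coeff_add, coeff_C_mul, coeff_X_mul, coeff_X_mul, finsetSum_coeff]
        simp only [coeff_C_mul]
        ring
      have h := hx.succ n
      rw [Finset.sum_range_succ', hc0, h]
      simp only [hc, Finset.sum_add_distrib, mul_sub, Finset.sum_sub_distrib]
      rw [Finset.sum_comm]
      simp only [Finset.mul_sum]
      ring
  refine ((hA.tendsto_div hx ht0 ht1).const_sub 1).congr fun n => ?_
  have : (m n : ℝ) ≠ 0 := (hx.pos n).ne'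
  field_simp
  ring
end

section
/- For all integers k, ℓ ≥ 0, the mixed derivatives of the loop-counting polynomials satisfy lim_{n→∞} (∂_v^k ∂_w^ℓ y_n)(1,1) / (n^{k+ℓ+1}·φ(n)) = η(k,ℓ). -/
open MvPolynomial Filter

/-- `φ(n) = (2n−1)!! = (2n)!/(2^n·n!)` (the division is exact). -/
def phi (n : ℕ) : ℕ := (2 * n).factorial / (2 ^ n * n.factorial)

theorem factorial_two_mul_eq_prod (n : ℕ) :
    (2 * n).factorial = 2 ^ n * n.factorial * ∏ i ∈ Finset.range n, (2 * i + 1) := by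
  induction n with
  | zero => simp
  | succ n ih =>
    rw [Finset.prod_range_succ, show 2 * (n + 1) = 2 * n + 1 + 1 by ring, Nat.factorial_succ,
      Nat.factorial_succ, ih, Nat.factorial_succ]
    ring

theorem phi_eq_prod (n : ℕ) : phi n = ∏ i ∈ Finset.range n, (2 * i + 1) := by
  rw [phi, factorial_two_mul_eq_prod]
  exact Nat.mul_div_cancel_left _ (by positivity)

theorem phi_zero : phi 0 = 1 := by simp [phi_eq_prod]

theorem phi_succ (n : ℕ) : phi (n + 1) = (2 * n + 1) * phi n := by
  rw [phi_eq_prod, phi_eq_prod, Finset.prod_range_succ, mul_comm]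

theorem phi_pos (n : ℕ) : 0 < phi n := by
  rw [phi_eq_prod]
  exact Finset.prod_pos fun i _ => by positivity

theorem phi_mul_phi_le (a b c : ℕ) : phi (a + c) * phi (b + c) ≤ phi c * phi (a + b + c) := by
  induction a with
  | zero => simp
  | succ a ih =>
    rw [show a + 1 + c = a + c + 1 by ring, show a + 1 + b + c = a + b + c + 1 by ring,
      phi_succ, phi_succ]
    calc (2 * (a + c) + 1) * phi (a + c) * phi (b + c)
        = (2 * (a + c) + 1) * (phi (a + c) * phi (b + c)) := by ring
      _ ≤ (2 * (a + b + c) + 1) * (phi c * phi (a + b + c)) := by gcongr; omega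
      _ = _ := by ring

theorem sum_phi_mul_phi_le (N : ℕ) :
    ∑ i ∈ Finset.range (N + 1), phi (i + 2) * phi (N - i + 2) ≤ 14 * phi (N + 2) := by
  have h0 : phi 0 = 1 := phi_zero
  have h1 : phi 1 = 1 := by rw [phi_succ, h0]
  have h2 : phi 2 = 3 := by rw [phi_succ, h1]
  have h3 : phi 3 = 15 := by rw [phi_succ, h2]
  rcases N with _ | N
  · simp [h2]
  · rw [Finset.sum_range_succ, Finset.sum_range_succ']
    have hmid : ∑ i ∈ Finset.range N, phi (i + 1 + 2) * phi (N + 1 - (i + 1) + 2)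
        ≤ ∑ _i ∈ Finset.range N, 15 * phi (N + 2) := by
      refine Finset.sum_le_sum fun i hi => ?_
      have hi := Finset.mem_range.1 hi
      have h := phi_mul_phi_le i (N - 1 - i) 3
      rwa [h3, show N - 1 - i + 3 = N + 1 - (i + 1) + 2 by omega,
        show i + (N - 1 - i) + 3 = N + 2 by omega] at h
    rw [Finset.sum_const, Finset.card_range, smul_eq_mul] at hmid
    have hs := phi_succ (N + 2)
    simp only [Nat.sub_self, Nat.sub_zero, zero_add, h2]
    have he : N + 1 + 2 = N + 2 + 1 := rfl
    rw [he, hs]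
    nlinarith [phi_pos (N + 2)]

/-- The rooted-map numbers and the double factorials are linked by
`φ(n+1) = ∑ m(k) φ(n-k)`: both sides come from Riccati-type equations of the generating series. -/
theorem phi_succ_eq_sum (m : ℕ → ℝ) (h0 : m 0 = 1)
    (hm : ∀ n, m (n + 1) = ∑ i ∈ Finset.range (n + 1), m i * m (n - i) + (2 * n + 1) * m n)
    (n : ℕ) : (phi (n + 1) : ℝ) = ∑ k ∈ Finset.range (n + 1), m k * phi (n - k) := by
  set M : PowerSeries ℝ := PowerSeries.mk m with hM
  set F : PowerSeries ℝ := PowerSeries.mk fun n => (phi n : ℝ) with hF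
  have hXd : ∀ (G : PowerSeries ℝ) (n : ℕ),
      PowerSeries.coeff n (PowerSeries.X * PowerSeries.derivative ℝ G)
        = n * PowerSeries.coeff n G := by
    intro G n
    cases n with
    | zero => simp
    | succ n => rw [PowerSeries.coeff_succ_X_mul, PowerSeries.coeff_derivative]; push_cast; ring
  have hMeq : M = 1 + PowerSeries.X * (M * M
      + 2 * (PowerSeries.X * PowerSeries.derivative ℝ M) + M) := by
    ext n
    cases n with
    | zero => simp [hM, h0]
    | succ n =>
      rw [map_add, PowerSeries.coeff_succ_X_mul, map_add, map_add, two_mul, map_add, hXd,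
        PowerSeries.coeff_mul,
        Finset.Nat.sum_antidiagonal_eq_sum_range_succ_mk]
      simp only [hM, PowerSeries.coeff_mk, PowerSeries.coeff_one, hm n]
      simp
      ring
  have hFeq : F = 1 + PowerSeries.X * (F
      + 2 * (PowerSeries.X * PowerSeries.derivative ℝ F)) := by
    ext n
    cases n with
    | zero => simp [hF, phi_zero]
    | succ n =>
      rw [map_add, PowerSeries.coeff_succ_X_mul, map_add, two_mul, map_add, hXd]
      simp only [hF, PowerSeries.coeff_mk, PowerSeries.coeff_one, phi_succ n]
      simp
      ring
  set Q : PowerSeries ℝ := F * (1 - PowerSeries.X * M) - 1 with hQ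
  have hdQ : PowerSeries.derivative ℝ Q = PowerSeries.derivative ℝ F * (1 - PowerSeries.X * M)
      - F * (M + PowerSeries.X * PowerSeries.derivative ℝ M) := by
    rw [hQ]
    simp [Derivation.leibniz]
    ring
  have hQeq : Q = PowerSeries.X * (M * Q
      + 2 * (PowerSeries.X * PowerSeries.derivative ℝ Q)) := by
    rw [hdQ, hQ]
    linear_combination (1 - PowerSeries.X * M) * hFeq - (F * PowerSeries.X) * hMeq
  have hQ0 : ∀ n, PowerSeries.coeff n Q = 0 := by
    intro n
    induction n using Nat.strong_induction_on with
    | _ n ih =>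
      rw [hQeq]
      cases n with
      | zero => simp
      | succ n =>
        rw [PowerSeries.coeff_succ_X_mul, map_add, two_mul, map_add, hXd, PowerSeries.coeff_mul,
          ih n (Nat.lt_succ_self n), Finset.sum_eq_zero]
        · simp
        · intro x hx
          have := Finset.HasAntidiagonal.mem_antidiagonal.1 hx
          rw [ih x.2 (by omega), mul_zero]
  have h := hQ0 (n + 1)
  rw [hQ, mul_sub, mul_one, ← mul_assoc, mul_comm F, mul_assoc, map_sub, map_sub,
    PowerSeries.coeff_succ_X_mul, mul_comm F, PowerSeries.coeff_mul,
    Finset.Nat.sum_antidiagonal_eq_sum_range_succ_mk] at h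
  simp [hM, hF, PowerSeries.coeff_one] at h
  linarith

theorem tendsto_zero_of_contraction {β : ℝ} (hβ : 0 < β) {d ε : ℕ → ℝ}
    (hε : Tendsto ε atTop (nhds 0))
    (hd : ∀ᶠ n : ℕ in atTop, d (n + 1) = (1 - β / (n + 1)) * d n + ε n / (n + 1)) :
    Tendsto d atTop (nhds 0) := by
  rw [Metric.tendsto_atTop]
  intro δ hδ
  have h1 : ∀ᶠ n : ℕ in atTop, |ε n| ≤ β * (δ / 2) := by
    have := (tendsto_order.1 hε.abs).2 (β * (δ / 2)) (by simpa using by positivity)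
    exact this.mono fun n h => h.le
  have h2 : ∀ᶠ n : ℕ in atTop, β ≤ (n : ℝ) := tendsto_natCast_atTop_atTop.eventually_ge_atTop β
  obtain ⟨N, hN⟩ := eventually_atTop.1 (hd.and (h1.and h2))
  set H : ℕ → ℝ := fun n => ∑ i ∈ Finset.range n, 1 / ((i : ℝ) + 1) with hH
  set A : ℝ := |(|d N| - δ / 2)| with hA
  have key : ∀ n, N ≤ n → |d n| - δ / 2 ≤ Real.exp (-β * (H n - H N)) * A := by
    intro n hn
    induction n, hn using Nat.le_induction with
    | base => simpa using le_abs_self (|d N| - δ / 2)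
    | succ n hn ih =>
      obtain ⟨hd, he, hb⟩ := hN n hn
      have hpos : (0 : ℝ) < (n : ℝ) + 1 := by positivity
      have hx : 0 ≤ 1 - β / ((n : ℝ) + 1) := by
        rw [sub_nonneg, div_le_one hpos]; linarith
      have hHs : H (n + 1) = H n + 1 / ((n : ℝ) + 1) := Finset.sum_range_succ _ _
      calc |d (n + 1)| - δ / 2
          ≤ (1 - β / (n + 1)) * |d n| + β * (δ / 2) / (n + 1) - δ / 2 := by
            rw [hd]
            gcongr
            refine (abs_add_le _ _).trans ?_
            rw [abs_mul, abs_of_nonneg hx, abs_div, abs_of_pos hpos]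
            gcongr
        _ = (1 - β / (n + 1)) * (|d n| - δ / 2) := by ring
        _ ≤ (1 - β / (n + 1)) * (Real.exp (-β * (H n - H N)) * A) := by gcongr
        _ ≤ Real.exp (-(β / (n + 1))) * (Real.exp (-β * (H n - H N)) * A) := by
            gcongr
            exact Real.one_sub_le_exp_neg _
        _ = _ := by
            rw [← mul_assoc, ← Real.exp_add, hHs]
            congr 2
            ring
  have hlim : Tendsto (fun n => Real.exp (-β * (H n - H N)) * A) atTop (nhds (0 * A)) := by
    refine Tendsto.mul_const _ (Real.tendsto_exp_atBot.comp ?_)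
    refine Tendsto.const_mul_atTop_of_neg (by linarith) ?_
    exact tendsto_atTop_add_const_right _ _ Real.tendsto_sum_range_one_div_nat_succ_atTop
  rw [zero_mul] at hlim
  obtain ⟨N', hN'⟩ := eventually_atTop.1 ((tendsto_order.1 hlim).2 (δ / 2) (by positivity))
  refine ⟨max N N', fun n hn => ?_⟩
  have a1 := key n (le_of_max_le_left hn)
  have a2 := hN' n (le_of_max_le_right hn)
  rw [Real.dist_eq, sub_zero]
  linarith

theorem tendsto_natCast_div_succ_pow (K : ℕ) :
    Tendsto (fun n : ℕ => ((n : ℝ) / (n + 1)) ^ K) atTop (nhds 1) := by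
  simpa using (tendsto_natCast_div_add_atTop (𝕜 := ℝ) (1 : ℝ)).pow K

theorem tendsto_succ_mul_pow_sub_one (K : ℕ) :
    Tendsto (fun n : ℕ => ((n : ℝ) + 1) * (((n : ℝ) / (n + 1)) ^ K - 1)) atTop
      (nhds (-(K : ℝ))) := by
  induction K with
  | zero => simp
  | succ K ih =>
    have h := ((tendsto_natCast_div_succ_pow 1).mul ih).sub_const 1
    rw [show (1 : ℝ) * -(K : ℝ) - 1 = -((K + 1 : ℕ) : ℝ) by push_cast; ring] at h
    refine h.congr fun n => ?_
    have : ((n : ℝ) + 1) ≠ 0 := by positivity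
    rw [pow_one, pow_succ _ K]
    generalize ((n : ℝ) / (n + 1)) ^ K = R
    field_simp
    ring

theorem tendsto_two_mul_add_one_div (c : ℝ) :
    Tendsto (fun n : ℕ => ((n : ℝ) + c) / (2 * n + 1)) atTop (nhds (1 / 2)) := by
  have h1 : Tendsto (fun n : ℕ => 1 / (n : ℝ)) atTop (nhds 0) := tendsto_one_div_atTop_nhds_zero_nat
  have h := ((h1.const_mul c).const_add 1).div (h1.const_add 2) (by norm_num)
  simp only [mul_zero, add_zero] at h
  refine h.congr' ?_
  filter_upwards [eventually_gt_atTop 0] with n hn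
  have : (n : ℝ) ≠ 0 := by positivity
  simp only [Pi.div_apply]
  field_simp

theorem tendsto_of_linear_recurrence {a S : ℕ → ℝ} {K : ℕ} {α s C : ℝ}
    (hα : α < 2 * ((K : ℝ) + 1))
    (hrec : ∀ᶠ n : ℕ in atTop, a (n + 1) = (2 * n + 1 + α) * a n + S n)
    (hS : Tendsto (fun n : ℕ => S n / ((n : ℝ) ^ (K + 1) * phi n)) atTop (nhds s))
    (hb : ∀ᶠ n : ℕ in atTop, |a n / ((n : ℝ) ^ (K + 1) * phi n)| ≤ C) :
    Tendsto (fun n : ℕ => a n / ((n : ℝ) ^ (K + 1) * phi n)) atTop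
      (nhds (s / (2 * ((K : ℝ) + 1) - α))) := by
  set u : ℕ → ℝ := fun n => a n / ((n : ℝ) ^ (K + 1) * phi n) with hu
  set T : ℕ → ℝ := fun n => S n / ((n : ℝ) ^ (K + 1) * phi n) with hT
  set β : ℝ := (K : ℝ) + 1 - α / 2 with hβ
  have hβ0 : 0 < β := by rw [hβ]; linarith
  have hL : s / (2 * ((K : ℝ) + 1) - α) = s / 2 / β := by
    rw [div_div]; congr 1; rw [hβ]; ring
  rw [hL]
  set r : ℕ → ℝ := fun n => ((n : ℝ) + 1) * (((n : ℝ) / (n + 1)) ^ (K + 1) - 1)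
    + α * (((n : ℝ) + 1) / (2 * n + 1) * ((n : ℝ) / (n + 1)) ^ (K + 1)) + β with hr
  have hr0 : Tendsto r atTop (nhds 0) := by
    have h := ((tendsto_succ_mul_pow_sub_one (K + 1)).add
      (((tendsto_two_mul_add_one_div 1).mul (tendsto_natCast_div_succ_pow (K + 1))).const_mul
        α)).add_const β
    convert h using 2
    rw [hβ]; push_cast; ring
  have hru : Tendsto (fun n => r n * u n) atTop (nhds 0) := by
    refine squeeze_zero_norm' (a := fun n => |r n| * C) ?_ (by simpa using hr0.abs.mul_const C)
    filter_upwards [hb] with n hn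
    rw [Real.norm_eq_abs, abs_mul]
    gcongr
  set ε : ℕ → ℝ := fun n => r n * u n
    + (((n : ℝ) + 1) / (2 * n + 1) * ((n : ℝ) / (n + 1)) ^ (K + 1) * T n - s / 2) with hε
  have hε0 : Tendsto ε atTop (nhds 0) := by
    have h := hru.add ((((tendsto_two_mul_add_one_div 1).mul
      (tendsto_natCast_div_succ_pow (K + 1))).mul hS).sub_const (s / 2))
    convert h using 2
    ring
  have hd : Tendsto (fun n => u n - s / 2 / β) atTop (nhds 0) := by
    refine tendsto_zero_of_contraction hβ0 hε0 ?_
    filter_upwards [hrec, eventually_gt_atTop 0] with n hn hn0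
    have hn1 : (0 : ℝ) < n := by exact_mod_cast hn0
    have hn2 : (0 : ℝ) < (n : ℝ) + 1 := by linarith
    have hn3 : (0 : ℝ) < 2 * (n : ℝ) + 1 := by linarith
    have hp : (0 : ℝ) < phi n := by exact_mod_cast phi_pos n
    have ha : a n = u n * ((n : ℝ) ^ (K + 1) * phi n) := by
      rw [hu]; field_simp
    have hSn : S n = T n * ((n : ℝ) ^ (K + 1) * phi n) := by
      rw [hT]; field_simp
    have hun : u (n + 1) = ((n : ℝ) / (n + 1)) ^ (K + 1) / (2 * n + 1)
        * ((2 * n + 1 + α) * u n + T n) := by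
      change a (n + 1) / _ = _
      rw [hn, ha, hSn, phi_succ]
      push_cast
      rw [div_pow]
      field_simp
    rw [hun]
    simp only [hε, hr]
    generalize ((n : ℝ) / (n + 1)) ^ (K + 1) = R
    field_simp
    ring
  simpa using hd.add_const (s / 2 / β)

/-- Polynomials with nonnegative coefficients all of whose exponents are at most `d`. -/
noncomputable def nonnegCone (d : ℕ) : AddSubmonoid (MvPolynomial (Fin 2) ℝ) :=
  AddSubmonoid.closure {p | ∃ (s : Fin 2 →₀ ℕ) (c : ℝ), 0 ≤ c ∧ (∀ i, s i ≤ d) ∧ p = monomial s c}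

theorem monomial_mem_nonnegCone {d : ℕ} {s : Fin 2 →₀ ℕ} {c : ℝ} (hc : 0 ≤ c)
    (hs : ∀ i, s i ≤ d) : monomial s c ∈ nonnegCone d :=
  AddSubmonoid.subset_closure ⟨s, c, hc, hs, rfl⟩

theorem C_mem_nonnegCone {c : ℝ} (hc : 0 ≤ c) : C c ∈ nonnegCone 0 :=
  monomial_mem_nonnegCone hc (by simp)

theorem X_mem_nonnegCone (i : Fin 2) : X i ∈ nonnegCone 1 :=
  monomial_mem_nonnegCone zero_le_one fun j => by
    rw [Finsupp.single_apply]; split_ifs <;> simp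

theorem X_zero_mul_X_one_mem_nonnegCone : X 0 * X 1 ∈ nonnegCone 1 := by
  rw [X, X, monomial_mul, mul_one]
  refine monomial_mem_nonnegCone zero_le_one fun j => ?_
  fin_cases j <;> simp

theorem nonnegCone_induction {d : ℕ} {P : MvPolynomial (Fin 2) ℝ → Prop}
    (hmon : ∀ (s : Fin 2 →₀ ℕ) (c : ℝ), 0 ≤ c → (∀ i, s i ≤ d) → P (monomial s c))
    (hzero : P 0) (hadd : ∀ p q, P p → P q → P (p + q))
    {p : MvPolynomial (Fin 2) ℝ} (hp : p ∈ nonnegCone d) : P p := by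
  induction hp using AddSubmonoid.closure_induction with
  | mem x hx =>
    obtain ⟨s, c, hc, hs, rfl⟩ := hx
    exact hmon s c hc hs
  | zero => exact hzero
  | add x y _ _ h1 h2 => exact hadd x y h1 h2

theorem nonnegCone_mono {d e : ℕ} (h : d ≤ e) : nonnegCone d ≤ nonnegCone e := fun _ hp =>
  nonnegCone_induction (fun _ _ hc hs => monomial_mem_nonnegCone hc fun i => (hs i).trans h)
    (zero_mem _) (fun _ _ => add_mem) hp

theorem mul_mem_nonnegCone {d e : ℕ} {p q : MvPolynomial (Fin 2) ℝ} (hp : p ∈ nonnegCone d)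
    (hq : q ∈ nonnegCone e) : p * q ∈ nonnegCone (d + e) := by
  refine nonnegCone_induction (P := fun p => p * q ∈ nonnegCone (d + e)) ?_ (by simp)
    (fun p p' h h' => by rw [add_mul]; exact add_mem h h') hp
  intro s c hc hs
  refine nonnegCone_induction (P := fun q => monomial s c * q ∈ nonnegCone (d + e)) ?_ (by simp)
    (fun p p' h h' => by rw [mul_add]; exact add_mem h h') hq
  intro t c' hc' ht
  rw [monomial_mul]
  exact monomial_mem_nonnegCone (mul_nonneg hc hc') fun i => add_le_add (hs i) (ht i)

theorem pderiv_mem_nonnegCone {d : ℕ} {p : MvPolynomial (Fin 2) ℝ} (hp : p ∈ nonnegCone d)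
    (i : Fin 2) : pderiv i p ∈ nonnegCone d := by
  refine nonnegCone_induction (P := fun p => pderiv i p ∈ nonnegCone d) ?_ (by simp)
    (fun p p' h h' => by rw [map_add]; exact add_mem h h') hp
  intro s c hc hs
  rw [pderiv_monomial]
  exact monomial_mem_nonnegCone (by positivity) fun j =>
    (Nat.sub_le _ _).trans (hs j)

theorem X_mul_pderiv_mem_nonnegCone {d : ℕ} {p : MvPolynomial (Fin 2) ℝ}
    (hp : p ∈ nonnegCone d) (i : Fin 2) : X i * pderiv i p ∈ nonnegCone d := by
  refine nonnegCone_induction (P := fun p => X i * pderiv i p ∈ nonnegCone d) ?_ (by simp)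
    (fun p p' h h' => by rw [map_add, mul_add]; exact add_mem h h') hp
  intro s c hc hs
  rw [X_mul_pderiv_monomial]
  exact nsmul_mem (monomial_mem_nonnegCone hc hs) _

theorem C_mul_sub_X_mul_pderiv_mem_nonnegCone {d : ℕ} {p : MvPolynomial (Fin 2) ℝ}
    (hp : p ∈ nonnegCone d) (i : Fin 2) : C (d : ℝ) * p - X i * pderiv i p ∈ nonnegCone d := by
  refine nonnegCone_induction
    (P := fun p => C (d : ℝ) * p - X i * pderiv i p ∈ nonnegCone d) ?_ (by simp)
    (fun p p' h h' => by
      rw [map_add, mul_add, mul_add, add_sub_add_comm]; exact add_mem h h') hp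
  intro s c hc hs
  rw [X_mul_pderiv_monomial, C_mul_monomial, ← map_nsmul, ← map_sub]
  refine monomial_mem_nonnegCone ?_ hs
  have : (s i : ℝ) ≤ d := by exact_mod_cast hs i
  rw [nsmul_eq_mul]
  nlinarith

/-- The substitution `v = 1`. -/
noncomputable def specializeRoot : MvPolynomial (Fin 2) ℝ →ₐ[ℝ] MvPolynomial (Fin 2) ℝ :=
  aeval fun j : Fin 2 => if j = 0 then (1 : MvPolynomial (Fin 2) ℝ) else X 1

theorem specializeRoot_X_zero : specializeRoot (X 0) = 1 := by simp [specializeRoot]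

theorem specializeRoot_X_one : specializeRoot (X 1) = X 1 := by simp [specializeRoot]

theorem specializeRoot_mem_nonnegCone {d : ℕ} {p : MvPolynomial (Fin 2) ℝ}
    (hp : p ∈ nonnegCone d) : specializeRoot p ∈ nonnegCone d := by
  refine nonnegCone_induction (P := fun p => specializeRoot p ∈ nonnegCone d) ?_ (by simp)
    (fun p p' h h' => by rw [map_add]; exact add_mem h h') hp
  intro s c hc hs
  have : specializeRoot (monomial s c) = monomial (Finsupp.single 1 (s 1)) c := by
    rw [specializeRoot, aeval_monomial, Finsupp.prod_fintype _ _ (by simp), Fin.prod_univ_two,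
      monomial_eq]
    simp
  rw [this]
  refine monomial_mem_nonnegCone hc fun i => ?_
  rw [Finsupp.single_apply]
  split_ifs
  · exact hs 1
  · exact Nat.zero_le d

theorem pderiv_zero_specializeRoot (p : MvPolynomial (Fin 2) ℝ) :
    pderiv 0 (specializeRoot p) = 0 := by
  induction p using MvPolynomial.induction_on with
  | C a => simp [specializeRoot]
  | add p q hp hq => rw [map_add, map_add, hp, hq, add_zero]
  | mul_X p i hp =>
    rw [map_mul, pderiv_mul, hp]
    fin_cases i
    · simp [specializeRoot_X_zero]
    · simp [specializeRoot_X_one]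

theorem pderiv_one_specializeRoot (p : MvPolynomial (Fin 2) ℝ) :
    pderiv 1 (specializeRoot p) = specializeRoot (pderiv 1 p) := by
  induction p using MvPolynomial.induction_on with
  | C a => simp [specializeRoot]
  | add p q hp hq => simp only [map_add, hp, hq]
  | mul_X p i hp =>
    rw [map_mul, pderiv_mul, hp, pderiv_mul, map_add, map_mul, map_mul]
    fin_cases i
    · simp [specializeRoot_X_zero]
    · simp [specializeRoot_X_one]

theorem eval_specializeRoot (p : MvPolynomial (Fin 2) ℝ) :
    eval (fun _ => (1 : ℝ)) (specializeRoot p) = eval (fun _ => (1 : ℝ)) p := by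
  induction p using MvPolynomial.induction_on with
  | C a => simp [specializeRoot]
  | add p q hp hq => simp only [map_add, hp, hq]
  | mul_X p i hp =>
    rw [map_mul, map_mul, hp, map_mul]
    fin_cases i
    · simp [specializeRoot_X_zero]
    · simp [specializeRoot_X_one]

theorem pderiv_pderiv_comm (i j : Fin 2) (p : MvPolynomial (Fin 2) ℝ) :
    pderiv i (pderiv j p) = pderiv j (pderiv i p) := by
  have h : ⁅pderiv (R := ℝ) i, pderiv (R := ℝ) j⁆ = 0 := by
    refine derivation_ext fun k => ?_
    rw [Derivation.commutator_apply, pderiv_X, pderiv_X]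
    simp only [Pi.single_apply]
    split_ifs <;> simp
  have := DFunLike.congr_fun h p
  rw [Derivation.commutator_apply] at this
  exact sub_eq_zero.1 this

/-- The functional `p ↦ (∂_v^k ∂_w^ℓ p)(1,1)`. -/
noncomputable def mixedMoment (k l : ℕ) : MvPolynomial (Fin 2) ℝ →ₗ[ℝ] ℝ :=
  (aeval (R := ℝ) fun _ : Fin 2 => (1 : ℝ)).toLinearMap ∘ₗ
    ((pderiv (R := ℝ) (0 : Fin 2)).toLinearMap ^ k * (pderiv (R := ℝ) (1 : Fin 2)).toLinearMap ^ l)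

theorem mixedMoment_apply (k l : ℕ) (p : MvPolynomial (Fin 2) ℝ) :
    mixedMoment k l p = eval (fun _ : Fin 2 => (1 : ℝ))
      ((fun p => pderiv (0 : Fin 2) p)^[k] ((fun p => pderiv (1 : Fin 2) p)^[l] p)) := by
  simp only [mixedMoment, LinearMap.comp_apply, Module.End.mul_apply, Module.End.pow_apply]
  rw [← coe_aeval_eq_eval]
  rfl

theorem mixedMoment_zero_zero (p : MvPolynomial (Fin 2) ℝ) :
    mixedMoment 0 0 p = eval (fun _ => (1 : ℝ)) p := by
  simp [mixedMoment_apply]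

theorem mixedMoment_pderiv_one (k l : ℕ) (p : MvPolynomial (Fin 2) ℝ) :
    mixedMoment k l (pderiv 1 p) = mixedMoment k (l + 1) p := by
  simp [mixedMoment_apply]

theorem mixedMoment_pderiv_zero (k l : ℕ) (p : MvPolynomial (Fin 2) ℝ) :
    mixedMoment k l (pderiv 0 p) = mixedMoment (k + 1) l p := by
  induction l generalizing p with
  | zero => simp [mixedMoment_apply]
  | succ l ih => rw [← mixedMoment_pderiv_one, pderiv_pderiv_comm, ih, mixedMoment_pderiv_one]

theorem mixedMoment_X_zero_mul (k l : ℕ) (p : MvPolynomial (Fin 2) ℝ) :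
    mixedMoment k l (X 0 * p) = mixedMoment k l p + k * mixedMoment (k - 1) l p := by
  induction k generalizing p with
  | zero =>
    induction l generalizing p with
    | zero => simp [mixedMoment_zero_zero]
    | succ l ih =>
      rw [← mixedMoment_pderiv_one, pderiv_mul, pderiv_X_of_ne (by decide), zero_mul, zero_add, ih]
      simp [mixedMoment_pderiv_one]
  | succ k ih =>
    rw [← mixedMoment_pderiv_zero, pderiv_mul, pderiv_X_self, one_mul, map_add, ih]
    rcases k with _ | k
    · simp [mixedMoment_pderiv_zero]
      ring
    · simp [mixedMoment_pderiv_zero]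
      ring

theorem mixedMoment_X_one_mul (k l : ℕ) (p : MvPolynomial (Fin 2) ℝ) :
    mixedMoment k l (X 1 * p) = mixedMoment k l p + l * mixedMoment k (l - 1) p := by
  induction l generalizing p with
  | zero =>
    induction k generalizing p with
    | zero => simp [mixedMoment_zero_zero]
    | succ k ih =>
      rw [← mixedMoment_pderiv_zero, pderiv_mul, pderiv_X_of_ne (by decide), zero_mul, zero_add, ih]
      simp [mixedMoment_pderiv_zero]
  | succ l ih =>
    rw [← mixedMoment_pderiv_one, pderiv_mul, pderiv_X_self, one_mul, map_add, ih]
    rcases l with _ | l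
    · simp [mixedMoment_pderiv_one]
      ring
    · simp [mixedMoment_pderiv_one]
      ring

theorem mixedMoment_specializeRoot (k l : ℕ) (p : MvPolynomial (Fin 2) ℝ) :
    mixedMoment k l (specializeRoot p) = (if k = 0 then 1 else 0) * mixedMoment k l p := by
  cases k with
  | zero =>
    rw [if_pos rfl, one_mul]
    induction l generalizing p with
    | zero => simp [mixedMoment_zero_zero, eval_specializeRoot]
    | succ l ih =>
      rw [← mixedMoment_pderiv_one, pderiv_one_specializeRoot, ih, mixedMoment_pderiv_one]
  | succ k => rw [← mixedMoment_pderiv_zero, pderiv_zero_specializeRoot]; simp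

theorem eval_nonneg_of_mem_nonnegCone {d : ℕ} {p : MvPolynomial (Fin 2) ℝ}
    (hp : p ∈ nonnegCone d) : 0 ≤ eval (fun _ => (1 : ℝ)) p :=
  nonnegCone_induction (P := fun p => 0 ≤ eval (fun _ => (1 : ℝ)) p)
    (fun s c hc _ => by simpa [eval_monomial] using hc) (by simp)
    (fun p q hp hq => by rw [map_add]; exact add_nonneg hp hq) hp

theorem eval_pderiv_le {d : ℕ} {p : MvPolynomial (Fin 2) ℝ} (hp : p ∈ nonnegCone d) (i : Fin 2) :
    eval (fun _ => (1 : ℝ)) (pderiv i p) ≤ d * eval (fun _ => (1 : ℝ)) p := by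
  have h := eval_nonneg_of_mem_nonnegCone (C_mul_sub_X_mul_pderiv_mem_nonnegCone hp i)
  simpa using h

theorem mixedMoment_nonneg {d : ℕ} {p : MvPolynomial (Fin 2) ℝ} (hp : p ∈ nonnegCone d)
    (k l : ℕ) : 0 ≤ mixedMoment k l p := by
  induction k generalizing p with
  | zero =>
    induction l generalizing p with
    | zero => rw [mixedMoment_zero_zero]; exact eval_nonneg_of_mem_nonnegCone hp
    | succ l ih => rw [← mixedMoment_pderiv_one]; exact ih (pderiv_mem_nonnegCone hp 1)
  | succ k ih => rw [← mixedMoment_pderiv_zero]; exact ih (pderiv_mem_nonnegCone hp 0)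

theorem mixedMoment_le {d : ℕ} {p : MvPolynomial (Fin 2) ℝ} (hp : p ∈ nonnegCone d)
    (k l : ℕ) : mixedMoment k l p ≤ (d : ℝ) ^ (k + l) * eval (fun _ => (1 : ℝ)) p := by
  induction k generalizing p with
  | zero =>
    induction l generalizing p with
    | zero => simp [mixedMoment_zero_zero]
    | succ l ih =>
      rw [← mixedMoment_pderiv_one]
      refine (ih (pderiv_mem_nonnegCone hp 1)).trans ?_
      rw [← add_assoc, pow_succ, mul_assoc]
      gcongr
      exact eval_pderiv_le hp 1
  | succ k ih =>
    rw [← mixedMoment_pderiv_zero]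
    refine (ih (pderiv_mem_nonnegCone hp 0)).trans ?_
    rw [add_right_comm, pow_succ, mul_assoc]
    gcongr
    exact eval_pderiv_le hp 0

theorem mul_mixedMoment_le {d : ℕ} {p : MvPolynomial (Fin 2) ℝ}
    (hp : p ∈ nonnegCone d) {c B : ℝ} (hc0 : 0 ≤ c) {i j r K : ℕ} (hc : c = 0 ∨ i + j + r = K)
    (hB : eval (fun _ => (1 : ℝ)) p ≤ (d : ℝ) ^ r * B) :
    c * mixedMoment i j p ≤ c * ((d : ℝ) ^ K * B) := by
  rcases hc with rfl | rfl
  · simp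
  · gcongr
    refine (mixedMoment_le hp i j).trans ?_
    rw [pow_add _ (i + j), mul_assoc]
    gcongr

section LoopPolynomials

variable {y : ℕ → MvPolynomial (Fin 2) ℝ}

/-- The recurrence defining the loop-counting polynomials. -/
def LoopRecurrence (y : ℕ → MvPolynomial (Fin 2) ℝ) : Prop :=
  ∀ n : ℕ, y (n + 1) = X 0 * y n + C (2 * (n : ℝ)) * X 0 * y n +
    X 0 * ∑ i ∈ Finset.range (n + 1), specializeRoot (y i) * y (n - i) +
    X 0 ^ 2 * (X 0 * X 1 - 1) * pderiv (0 : Fin 2) (y n)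

theorem LoopRecurrence.mem_nonnegCone (hy : LoopRecurrence y) (hy0 : y 0 = 1) (n : ℕ) :
    y n ∈ nonnegCone (2 * n) := by
  induction n using Nat.strong_induction_on with
  | _ n ih =>
    rcases n with _ | n
    · rw [hy0]
      simpa using C_mem_nonnegCone zero_le_one
    have hyn := ih n n.lt_succ_self
    have hsum : ∑ i ∈ Finset.range (n + 1), specializeRoot (y i) * y (n - i)
        ∈ nonnegCone (2 * n) := by
      refine sum_mem fun i hi => ?_
      have hi := Finset.mem_range.1 hi
      have h := mul_mem_nonnegCone (specializeRoot_mem_nonnegCone (ih i (by omega)))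
        (ih (n - i) (by omega))
      rwa [show 2 * i + 2 * (n - i) = 2 * n by omega] at h
    have hsub := C_mul_sub_X_mul_pderiv_mem_nonnegCone hyn 0
    have hmul := mul_mem_nonnegCone X_zero_mul_X_one_mem_nonnegCone
      (X_mul_pderiv_mem_nonnegCone hyn 0)
    have h1 := mul_mem_nonnegCone (X_mem_nonnegCone 0) (add_mem (add_mem hyn hsum) hsub)
    have h2 := mul_mem_nonnegCone (X_mem_nonnegCone 0) hmul
    have hyeq : y (n + 1) = X 0 * (y n + ∑ i ∈ Finset.range (n + 1),
        specializeRoot (y i) * y (n - i) + (C ((2 * n : ℕ) : ℝ) * y n - X 0 * pderiv 0 (y n)))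
        + X 0 * (X 0 * X 1 * (X 0 * pderiv 0 (y n))) := by
      rw [hy n]
      push_cast
      ring
    rw [hyeq]
    exact add_mem (nonnegCone_mono (by omega) h1) (nonnegCone_mono (by omega) h2)

theorem LoopRecurrence.eval_succ (hy : LoopRecurrence y) (n : ℕ) :
    eval (fun _ => (1 : ℝ)) (y (n + 1)) =
      ∑ i ∈ Finset.range (n + 1), eval (fun _ => (1 : ℝ)) (y i) * eval (fun _ => (1 : ℝ)) (y (n - i))
        + (2 * n + 1) * eval (fun _ => (1 : ℝ)) (y n) := by
  rw [hy n]
  simp [eval_specializeRoot]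
  ring

theorem LoopRecurrence.phi_succ_eq_sum (hy : LoopRecurrence y) (hy0 : y 0 = 1) (n : ℕ) :
    (phi (n + 1) : ℝ) =
      ∑ k ∈ Finset.range (n + 1), eval (fun _ => (1 : ℝ)) (y k) * phi (n - k) :=
  _root_.phi_succ_eq_sum (fun n => eval (fun _ => (1 : ℝ)) (y n)) (by simp [hy0]) hy.eval_succ n

theorem LoopRecurrence.eval_nonneg (hy : LoopRecurrence y) (hy0 : y 0 = 1) (n : ℕ) :
    0 ≤ eval (fun _ => (1 : ℝ)) (y n) :=
  eval_nonneg_of_mem_nonnegCone (hy.mem_nonnegCone hy0 n)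

theorem LoopRecurrence.eval_le (hy : LoopRecurrence y) (hy0 : y 0 = 1) (n : ℕ) :
    eval (fun _ => (1 : ℝ)) (y n) ≤ phi (n + 1) := by
  rw [hy.phi_succ_eq_sum hy0, Finset.sum_range_succ, Nat.sub_self, phi_zero, Nat.cast_one, mul_one]
  exact le_add_of_nonneg_left (Finset.sum_nonneg fun i _ =>
    mul_nonneg (hy.eval_nonneg hy0 i) (Nat.cast_nonneg _))

theorem sum_phi_mul_phi_le_real (N : ℕ) :
    ∑ i ∈ Finset.range (N + 1), (phi (i + 2) : ℝ) * phi (N - i + 2) ≤ 14 * phi (N + 2) := by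
  exact_mod_cast sum_phi_mul_phi_le N

theorem LoopRecurrence.sum_eval_mul_eval_le (hy : LoopRecurrence y) (hy0 : y 0 = 1) (N : ℕ) :
    ∑ i ∈ Finset.range (N + 1), eval (fun _ => (1 : ℝ)) (y (i + 1)) *
      eval (fun _ => (1 : ℝ)) (y (N - i + 1)) ≤ 14 * phi (N + 2) := by
  refine le_trans (Finset.sum_le_sum fun i _ => ?_) (sum_phi_mul_phi_le_real N)
  exact mul_le_mul (hy.eval_le hy0 _) (hy.eval_le hy0 _) (hy.eval_nonneg hy0 _) (Nat.cast_nonneg _)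

theorem LoopRecurrence.le_eval (hy : LoopRecurrence y) (hy0 : y 0 = 1) (N : ℕ) :
    (phi (N + 3) : ℝ) - 15 * phi (N + 2) ≤ eval (fun _ => (1 : ℝ)) (y (N + 2)) := by
  have h := hy.phi_succ_eq_sum hy0 (N + 2)
  rw [Finset.sum_range_succ, Finset.sum_range_succ', hy0] at h
  have hle : ∑ i ∈ Finset.range (N + 1), eval (fun _ => (1 : ℝ)) (y (i + 1)) *
      (phi (N + 2 - (i + 1)) : ℝ) ≤ 14 * phi (N + 2) := by
    refine le_trans (Finset.sum_le_sum fun i hi => ?_) (sum_phi_mul_phi_le_real N)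
    have hi := Finset.mem_range.1 hi
    refine mul_le_mul (hy.eval_le hy0 _) ?_ (Nat.cast_nonneg _) (Nat.cast_nonneg _)
    rw [show N - i + 2 = N + 2 - (i + 1) + 1 by omega, phi_succ]
    exact_mod_cast Nat.le_mul_of_pos_left _ (by omega)
  simp [phi_zero] at h
  simp only [show N + 2 + 1 = N + 3 from rfl] at h hle ⊢
  have he : ∀ i, N + 2 - (i + 1) = N + 1 - i := fun i => by omega
  simp only [he] at hle
  linarith

theorem LoopRecurrence.tendsto_eval (hy : LoopRecurrence y) (hy0 : y 0 = 1) :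
    Tendsto (fun n : ℕ => eval (fun _ => (1 : ℝ)) (y n) / ((n : ℝ) ^ 1 * phi n)) atTop
      (nhds 2) := by
  have h1 : Tendsto (fun n : ℕ => 1 / (n : ℝ)) atTop (nhds 0) := tendsto_one_div_atTop_nhds_zero_nat
  have hlo : Tendsto (fun n : ℕ => 2 - 14 * (1 / (n : ℝ))) atTop (nhds 2) := by
    simpa using (h1.const_mul 14).const_sub 2
  have hup : Tendsto (fun n : ℕ => 2 + 1 / (n : ℝ)) atTop (nhds 2) := by
    simpa using h1.const_add 2
  refine tendsto_of_tendsto_of_tendsto_of_le_of_le' hlo hup ?_ ?_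
  all_goals
    filter_upwards [eventually_ge_atTop 2] with n hn
    obtain ⟨N, rfl⟩ := Nat.exists_eq_add_of_le' hn
    have hp : (0 : ℝ) < phi (N + 2) := by exact_mod_cast phi_pos _
    have hn0 : (0 : ℝ) < ((N + 2 : ℕ) : ℝ) := by positivity
    have hs : (phi (N + 3) : ℝ) = (2 * ((N + 2 : ℕ) : ℝ) + 1) * phi (N + 2) := by
      exact_mod_cast phi_succ (N + 2)
  · have h := hy.le_eval hy0 N
    rw [hs] at h
    rw [le_div_iff₀ (by positivity)]
    refine le_trans (le_of_eq ?_) h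
    field_simp
    ring
  · have h := hy.eval_le hy0 (N + 2)
    rw [show N + 2 + 1 = N + 3 from rfl, hs] at h
    rw [div_le_iff₀ (by positivity)]
    refine h.trans (le_of_eq ?_)
    field_simp

/-- The recurrence for the mixed derivatives at `(1,1)`, with an error term of lower order. -/
theorem LoopRecurrence.exists_mixedMoment_succ (hy : LoopRecurrence y) (hy0 : y 0 = 1)
    (k l : ℕ) : ∃ D : ℝ, ∀ n : ℕ, 2 ≤ n →
      ∃ ρ : ℝ, |ρ| ≤ D * ((n : ℝ) ^ (k + l) * phi n) ∧
        mixedMoment k l (y (n + 1)) =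
          (2 * n + 1 + ((k : ℝ) + 1 + if k = 0 then 1 else 0)) * mixedMoment k l (y n) +
          (2 * k * (n * mixedMoment (k - 1) l (y n)) + l * mixedMoment (k + 1) (l - 1) (y n) + ρ) := by
  refine ⟨(2 * k + k + 14 + l * k * 3 + k * (k - 1 : ℕ) * 2) * 4 ^ (k + l), fun n hn => ?_⟩
  obtain ⟨N, rfl⟩ := Nat.exists_eq_add_of_le' hn
  set n := N + 2 with hndef
  set mid : MvPolynomial (Fin 2) ℝ :=
    ∑ i ∈ Finset.range (N + 1), specializeRoot (y (i + 1)) * y (N - i + 1) with hmid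
  set q := pderiv (0 : Fin 2) (y n) with hq
  have hyn := hy.mem_nonnegCone hy0 n
  have hqc : q ∈ nonnegCone (2 * n) := pderiv_mem_nonnegCone hyn 0
  have hmidc : mid ∈ nonnegCone (2 * n) := by
    refine sum_mem fun i hi => ?_
    have hi := Finset.mem_range.1 hi
    exact nonnegCone_mono (by omega) (mul_mem_nonnegCone
      (specializeRoot_mem_nonnegCone (hy.mem_nonnegCone hy0 (i + 1)))
      (hy.mem_nonnegCone hy0 (N - i + 1)))
  have hdecomp : y (n + 1) = (2 * (n : ℝ) + 2) • (X 0 * y n) + X 0 * specializeRoot (y n) +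
      X 0 * mid + (X 1 * q - q) + (X 1 * (X 0 * (q + X 0 * q + X 0 * (X 0 * q)))
        - X 0 * (q + X 0 * q + X 0 * (X 0 * q)) - (X 1 * (q + X 0 * q + X 0 * (X 0 * q))
        - (q + X 0 * q + X 0 * (X 0 * q)))) + (X 0 * q - q) +
      (X 0 * (X 0 * (q + X 0 * q)) - X 0 * (q + X 0 * q) - (X 0 * (q + X 0 * q) - (q + X 0 * q))) := by
    rw [hy n, hndef, Finset.sum_range_succ, Finset.sum_range_succ', hy0, ← hndef]
    have hm : ∑ i ∈ Finset.range (N + 1), specializeRoot (y (i + 1)) * y (n - (i + 1)) = mid := by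
      refine Finset.sum_congr rfl fun i hi => ?_
      have hi := Finset.mem_range.1 hi
      rw [show n - (i + 1) = N - i + 1 by omega]
    rw [hm, smul_eq_C_mul]
    simp only [map_one, Nat.sub_zero, Nat.sub_self, hy0, C_add, ← hq]
    rw [show (C 2 : MvPolynomial (Fin 2) ℝ) = 2 from map_ofNat C 2]
    ring
  set r₁ := q + X 0 * q + X 0 * (X 0 * q) with hr₁
  set r₂ := q + X 0 * q with hr₂
  have hx : ∀ {d} {p : MvPolynomial (Fin 2) ℝ}, p ∈ nonnegCone d → X 0 * p ∈ nonnegCone (1 + d) :=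
    fun hp => mul_mem_nonnegCone (X_mem_nonnegCone 0) hp
  have hr₁c : r₁ ∈ nonnegCone (4 * n) :=
    add_mem (add_mem (nonnegCone_mono (by omega) hqc) (nonnegCone_mono (by omega) (hx hqc)))
      (nonnegCone_mono (by omega) (hx (hx hqc)))
  have hr₂c : r₂ ∈ nonnegCone (4 * n) :=
    add_mem (nonnegCone_mono (by omega) hqc) (nonnegCone_mono (by omega) (hx hqc))
  have hxmid : X 0 * mid ∈ nonnegCone (4 * n) := nonnegCone_mono (by omega) (hx hmidc)
  have hspec : specializeRoot (y n) ∈ nonnegCone (4 * n) :=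
    nonnegCone_mono (by omega) (specializeRoot_mem_nonnegCone hyn)
  have hync : y n ∈ nonnegCone (4 * n) := nonnegCone_mono (by omega) hyn
  set B : ℝ := (phi n : ℝ) with hB
  have hn2 : (2 : ℝ) ≤ n := by exact_mod_cast hn
  have hB0 : 0 < B := by rw [hB]; exact_mod_cast phi_pos n
  have hd : ((4 * n : ℕ) : ℝ) = 4 * n := by push_cast; ring
  have hey : eval (fun _ => (1 : ℝ)) (y n) ≤ ((4 * n : ℕ) : ℝ) * B := by
    refine (hy.eval_le hy0 n).trans ?_
    rw [phi_succ, hd, hB]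
    push_cast
    gcongr
    linarith
  have heq : eval (fun _ => (1 : ℝ)) q ≤ ((4 * n : ℕ) : ℝ) ^ 2 * B := by
    refine (eval_pderiv_le hync 0).trans ?_
    rw [pow_two, mul_assoc]
    gcongr
  have hemid : eval (fun _ => (1 : ℝ)) mid ≤ 14 * B := by
    rw [hmid]
    simp only [map_sum, map_mul, eval_specializeRoot]
    exact hy.sum_eval_mul_eval_le hy0 N
  set t₁ := 2 * (k : ℝ) * mixedMoment (k - 1) l (y n) with ht₁
  set t₂ := (k : ℝ) * mixedMoment (k - 1) l (specializeRoot (y n)) with ht₂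
  set t₃ := 1 * mixedMoment k l (X 0 * mid) with ht₃
  set t₄ := (l * k : ℝ) * mixedMoment (k - 1) (l - 1) r₁ with ht₄
  set t₅ := (k * (k - 1 : ℕ) : ℝ) * mixedMoment (k - 1 - 1) l r₂ with ht₅
  have b₁ : t₁ ≤ 2 * k * (((4 * n : ℕ) : ℝ) ^ (k + l) * B) :=
    mul_mixedMoment_le (r := 1) hync (by positivity)
      (by rcases k with _ | k; · simp
          right; omega) (by simpa using hey)
  have b₂ : t₂ ≤ k * (((4 * n : ℕ) : ℝ) ^ (k + l) * B) :=
    mul_mixedMoment_le (r := 1) hspec (by positivity)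
      (by rcases k with _ | k; · simp
          right; omega) (by simpa [eval_specializeRoot] using hey)
  have b₃ : t₃ ≤ 1 * (((4 * n : ℕ) : ℝ) ^ (k + l) * (14 * B)) :=
    mul_mixedMoment_le (r := 0) hxmid zero_le_one (by simp) (by simpa using hemid)
  have b₄ : t₄ ≤ l * k * (((4 * n : ℕ) : ℝ) ^ (k + l) * (3 * B)) :=
    mul_mixedMoment_le (r := 2) hr₁c (by positivity)
      (by rcases k with _ | k; · simp
          rcases l with _ | l; · simp
          right; omega) (by
        rw [hr₁, hr₂]
        simp only [map_add, map_mul, eval_X, one_mul]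
        linarith)
  have b₅ : t₅ ≤ k * (k - 1 : ℕ) * (((4 * n : ℕ) : ℝ) ^ (k + l) * (2 * B)) :=
    mul_mixedMoment_le (r := 2) hr₂c (by positivity)
      (by rcases k with _ | _ | k; · simp
          · simp
          right; omega) (by
        rw [hr₂]
        simp only [map_add, map_mul, eval_X, one_mul]
        linarith)
  refine ⟨t₁ + t₂ + t₃ + t₄ + t₅, ?_, ?_⟩
  · have c₁ : 0 ≤ t₁ := mul_nonneg (by positivity) (mixedMoment_nonneg hync _ _)
    have c₂ : 0 ≤ t₂ := mul_nonneg (by positivity) (mixedMoment_nonneg hspec _ _)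
    have c₃ : 0 ≤ t₃ := mul_nonneg (by positivity) (mixedMoment_nonneg hxmid _ _)
    have c₄ : 0 ≤ t₄ := mul_nonneg (by positivity) (mixedMoment_nonneg hr₁c _ _)
    have c₅ : 0 ≤ t₅ := mul_nonneg (by positivity) (mixedMoment_nonneg hr₂c _ _)
    rw [abs_of_nonneg (by positivity)]
    rw [hd, mul_pow] at b₁ b₂ b₃ b₄ b₅
    linarith
  · have hkq : (k : ℝ) * mixedMoment (k - 1) l q = k * mixedMoment k l (y n) := by
      rcases k with _ | k
      · simp
      · rw [hq, mixedMoment_pderiv_zero, Nat.add_sub_cancel]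
    have hlq : mixedMoment k (l - 1) q = mixedMoment (k + 1) (l - 1) (y n) :=
      mixedMoment_pderiv_zero _ _ _
    rw [hdecomp]
    simp only [map_add, map_sub, map_smul, mixedMoment_X_zero_mul k l (y n),
      mixedMoment_X_zero_mul k l (specializeRoot (y n)), mixedMoment_X_one_mul,
      mixedMoment_X_zero_mul _ _ q, mixedMoment_X_zero_mul _ _ r₁,
      mixedMoment_X_zero_mul _ _ (X 0 * r₂), mixedMoment_X_zero_mul _ _ r₂, hlq,
      mixedMoment_specializeRoot k, smul_eq_mul]
    rw [ht₁, ht₂, ht₃, ht₄, ht₅]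
    linear_combination hkq

theorem LoopRecurrence.mixedMoment_div_le (hy : LoopRecurrence y) (hy0 : y 0 = 1) (k l : ℕ) :
    ∀ᶠ n : ℕ in atTop,
      |mixedMoment k l (y n) / ((n : ℝ) ^ (k + l + 1) * phi n)| ≤ 2 ^ (k + l) * 3 := by
  filter_upwards [eventually_ge_atTop 1] with n hn
  have hn1 : (1 : ℝ) ≤ n := by exact_mod_cast hn
  have hp : (0 : ℝ) < phi n := by exact_mod_cast phi_pos n
  have hc := hy.mem_nonnegCone hy0 n
  rw [abs_of_nonneg (div_nonneg (mixedMoment_nonneg hc _ _) (by positivity)),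
    div_le_iff₀ (by positivity)]
  have he : eval (fun _ => (1 : ℝ)) (y n) ≤ 3 * n * phi n := by
    refine (hy.eval_le hy0 n).trans ?_
    rw [phi_succ]
    push_cast
    gcongr
    linarith
  calc mixedMoment k l (y n) ≤ ((2 * n : ℕ) : ℝ) ^ (k + l) * (3 * n * phi n) :=
        (mixedMoment_le hc k l).trans (by gcongr)
    _ = _ := by push_cast; rw [mul_pow]; ring

theorem LoopRecurrence.tendsto_mixedMoment_step (hy : LoopRecurrence y) (hy0 : y 0 = 1)
    {k l : ℕ} (hkl : ¬(k = 0 ∧ l = 0)) {η₁ η₂ : ℝ}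
    (h₁ : 0 < k → Tendsto (fun n : ℕ =>
      mixedMoment (k - 1) l (y n) / ((n : ℝ) ^ (k - 1 + l + 1) * phi n)) atTop (nhds η₁))
    (h₂ : 0 < l → Tendsto (fun n : ℕ =>
      mixedMoment (k + 1) (l - 1) (y n) / ((n : ℝ) ^ (k + 1 + (l - 1) + 1) * phi n))
        atTop (nhds η₂)) :
    Tendsto (fun n : ℕ => mixedMoment k l (y n) / ((n : ℝ) ^ (k + l + 1) * phi n)) atTop
      (nhds ((2 * (k : ℝ) * η₁ + (l : ℝ) * η₂) /
        ((k : ℝ) + 2 * (l : ℝ) + if 0 < k then 1 else 0))) := by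
  obtain ⟨D, hD⟩ := hy.exists_mixedMoment_succ hy0 k l
  choose! ρ hρ hrec using hD
  have hS₁ : Tendsto (fun n : ℕ => 2 * (k : ℝ) *
      (n * mixedMoment (k - 1) l (y n) / ((n : ℝ) ^ (k + l + 1) * phi n))) atTop
      (nhds (2 * k * η₁)) := by
    rcases k.eq_zero_or_pos with rfl | hk
    · simp
    refine Tendsto.const_mul _ ((h₁ hk).congr' ?_)
    filter_upwards [eventually_gt_atTop 0] with n hn
    have hn0 : (n : ℝ) ≠ 0 := by positivity
    rw [show k + l + 1 = k - 1 + l + 1 + 1 by omega, pow_succ _ (k - 1 + l + 1),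
      mul_right_comm, mul_comm (n : ℝ), mul_div_mul_right _ _ hn0]
  have hS₂ : Tendsto (fun n : ℕ => (l : ℝ) *
      (mixedMoment (k + 1) (l - 1) (y n) / ((n : ℝ) ^ (k + l + 1) * phi n))) atTop
      (nhds (l * η₂)) := by
    rcases l.eq_zero_or_pos with rfl | hl
    · simp
    rw [show k + l + 1 = k + 1 + (l - 1) + 1 by omega]
    exact (h₂ hl).const_mul _
  have hS₃ : Tendsto (fun n : ℕ => ρ n / ((n : ℝ) ^ (k + l + 1) * phi n)) atTop (nhds 0) := by
    refine squeeze_zero_norm' (a := fun n : ℕ => D * (1 / (n : ℝ))) ?_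
      (by simpa using (tendsto_one_div_atTop_nhds_zero_nat (𝕜 := ℝ)).const_mul D)
    filter_upwards [eventually_ge_atTop 2] with n hn
    have hn0 : (0 : ℝ) < n := by positivity
    have hp : (0 : ℝ) < phi n := by exact_mod_cast phi_pos n
    rw [Real.norm_eq_abs, abs_div, abs_of_pos (by positivity : 0 < (n : ℝ) ^ (k + l + 1) * phi n),
      div_le_iff₀ (by positivity)]
    refine (hρ n hn).trans (le_of_eq ?_)
    field_simp
    ring
  have hS := (hS₁.add hS₂).add hS₃
  rw [add_zero] at hS
  have hden : 2 * (((k + l : ℕ) : ℝ) + 1) - ((k : ℝ) + 1 + if k = 0 then 1 else 0)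
      = (k : ℝ) + 2 * l + if 0 < k then 1 else 0 := by
    rcases k.eq_zero_or_pos with rfl | hk
    · simp; ring
    · rw [if_neg hk.ne', if_pos hk]; push_cast; ring
  have hpos : 0 < (k : ℝ) + 2 * l + if 0 < k then 1 else 0 := by
    rcases k.eq_zero_or_pos with rfl | hk
    · have : 0 < l := by omega
      simpa using this
    · positivity
  rw [← hden]
  refine tendsto_of_linear_recurrence (by linarith)
    ((eventually_ge_atTop 2).mono fun n hn => hrec n hn) ?_ (hy.mixedMoment_div_le hy0 k l)
  refine hS.congr fun n => ?_
  ring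

end LoopPolynomials

/-- For all `k, ℓ ≥ 0`, the mixed derivatives of the loop-counting
polynomials `y_n(v,w)` (variable `X 0 = v` marking the root degree, `X 1 = w` marking
loops) satisfy `lim_{n→∞} (∂_v^k ∂_w^ℓ y_n)(1,1) / (n^{k+ℓ+1}·φ(n)) = η(k,ℓ)`. -/
theorem loops_mixed_moments
    (y : ℕ → MvPolynomial (Fin 2) ℝ) (hy0 : y 0 = 1)
    (hy : ∀ n : ℕ, y (n + 1) =
      X 0 * y n + C (2 * (n : ℝ)) * X 0 * y n +
        X 0 * ∑ i ∈ Finset.range (n + 1),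
          (aeval (fun j : Fin 2 => if j = 0 then (1 : MvPolynomial (Fin 2) ℝ) else X 1)
              (y i)) * y (n - i) +
        X 0 ^ 2 * (X 0 * X 1 - 1) * pderiv (0 : Fin 2) (y n))
    (η : ℕ → ℕ → ℝ) (hη0 : η 0 0 = 2)
    (hη : ∀ k ℓ : ℕ, ¬(k = 0 ∧ ℓ = 0) →
      η k ℓ = (2 * (k : ℝ) * η (k - 1) ℓ + (ℓ : ℝ) * η (k + 1) (ℓ - 1)) /
        ((k : ℝ) + 2 * (ℓ : ℝ) + if 0 < k then 1 else 0)) :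
    ∀ k ℓ : ℕ,
      Tendsto
        (fun n : ℕ =>
          eval (fun _ : Fin 2 => (1 : ℝ))
              ((fun p => pderiv (0 : Fin 2) p)^[k]
                ((fun p => pderiv (1 : Fin 2) p)^[ℓ] (y n))) /
            ((n : ℝ) ^ (k + ℓ + 1) * (phi n : ℝ)))
        atTop (nhds (η k ℓ)) := by
  have hrec : LoopRecurrence y := hy
  intro k l
  simp only [← mixedMoment_apply]
  induction l generalizing k with
  | zero =>
    induction k with
    | zero =>
      rw [hη0]
      simpa only [mixedMoment_zero_zero] using hrec.tendsto_eval hy0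
    | succ k ih =>
      rw [hη _ _ (by simp)]
      exact hrec.tendsto_mixedMoment_step hy0 (by simp) (fun _ => ih) (fun h => absurd h (by simp))
  | succ l ihl =>
    induction k with
    | zero =>
      rw [hη _ _ (by simp)]
      exact hrec.tendsto_mixedMoment_step hy0 (by simp) (fun h => absurd h (by simp))
        (fun _ => ihl 1)
    | succ k ih =>
      rw [hη _ _ (by simp)]
      exact hrec.tendsto_mixedMoment_step hy0 (by simp) (fun _ => ih) (fun _ => ihl (k + 2))
end
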